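/- arXiv:2104.10101 — 2 statements merged into one kernel-verified Lean document; each statement's English description precedes it below -/
import Mathlib

section
/- Let w ∈ S_n and I ⊆ J(w), and write D = [n−1] ∖ I = {d_1 < … < d_k}, d_0 = 0, d_{k+1} = n. Suppose w has an I-witness, i.e., a reduced word w = s_{i_1}⋯s_{i_{ℓ(w)}} such that each s_d with d ∈ D appears at most once and for each 1 ≤ t ≤ k+1, #{m : d_{t−1} < i_m < d_t} < binom(d_t − d_{t−1} + 1, 2). Then w has an I-witness of the form R = R′R″ where R′ is a reduced word for w_0(I) and R″ is a reduced word for w_0(I)w. -/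
open scoped Classical

namespace LSS

noncomputable section

open MvPolynomial

/-- The simple transposition `s_i ∈ S_n` (`1 ≤ i ≤ n-1`, 1-indexed): it exchanges the
letters `i` and `i+1` of `[n] = {1, …, n}`, realized on `Fin n` (0-indexed) as the swap
of `i-1` and `i`. For `i` out of range it is the identity. -/
def st (n : ℕ) (i : ℕ) : Equiv.Perm (Fin n) :=
  if h : 0 < i ∧ i < n then Equiv.swap ⟨i - 1, by omega⟩ ⟨i, h.2⟩ else 1

/-- Coxeter length of `w ∈ S_n` = number of inversions. -/
def len (n : ℕ) (w : Equiv.Perm (Fin n)) : ℕ :=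
  (Finset.univ.filter fun p : Fin n × Fin n => p.1 < p.2 ∧ w p.2 < w p.1).card

/-- `L` is a reduced word for `w`: a list of indices in `[n-1]` of length `ℓ(w)` whose
associated product of simple transpositions is `w`. -/
def IsRedWord (n : ℕ) (L : List ℕ) (w : Equiv.Perm (Fin n)) : Prop :=
  (∀ i ∈ L, 1 ≤ i ∧ i ≤ n - 1) ∧ (L.map (st n)).prod = w ∧ L.length = len n w

/-- The left descent set `J(w) = {j ∈ [n-1] : ℓ(s_j w) < ℓ(w)}`. -/
def Descents (n : ℕ) (w : Equiv.Perm (Fin n)) : Set ℕ :=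
  {j | 1 ≤ j ∧ j ≤ n - 1 ∧ len n (st n j * w) < len n w}

/-- The parabolic subgroup of `S_n` generated by `{s_i : i ∈ I}`. -/
def parab (n : ℕ) (I : Set ℕ) : Subgroup (Equiv.Perm (Fin n)) :=
  Subgroup.closure (st n '' I)

/-- `u = w_0(I)`, the longest element of the parabolic subgroup generated by `{s_i : i ∈ I}`. -/
def IsLongest (n : ℕ) (I : Set ℕ) (u : Equiv.Perm (Fin n)) : Prop :=
  u ∈ parab n I ∧ ∀ v ∈ parab n I, len n v ≤ len n u

/-- `c` is a standard Coxeter element of some parabolic subgroup of `S_n`: a product of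
the elements of some subset of `{s_1, …, s_{n-1}}`, each appearing exactly once, in some order. -/
def IsStdCox (n : ℕ) (c : Equiv.Perm (Fin n)) : Prop :=
  ∃ L : List ℕ, L.Nodup ∧ (∀ i ∈ L, 1 ≤ i ∧ i ≤ n - 1) ∧ (L.map (st n)).prod = c

/-- A weak composition `β : Fin n → ℕ` as an exponent vector. -/
def expOf (n : ℕ) (β : Fin n → ℕ) : Fin n →₀ ℕ := Finsupp.equivFunOnFinite.symm β

/-- The monomial `x^β = x_1^{β_1} ⋯ x_n^{β_n}`. -/
def mono (n : ℕ) (β : Fin n → ℕ) : MvPolynomial (Fin n) ℤ := monomial (expOf n β) 1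

/-- The coefficient `[x^β] f`. -/
def coeffOf (n : ℕ) (β : Fin n → ℕ) (f : MvPolynomial (Fin n) ℤ) : ℤ := coeff (expOf n β) f

/-- The isobaric divided difference (Demazure) operator
`π_i(f) = (x_i f − x_{i+1} s_i f)/(x_i − x_{i+1})` (1-indexed `i`), defined as the unique
polynomial `g` with `(x_i − x_{i+1})·g = x_i f − x_{i+1} s_i f`; such a `g` always exists
and is unique since `ℤ[x_1,…,x_n]` is a domain. -/
def dem (n : ℕ) (i : ℕ) (f : MvPolynomial (Fin n) ℤ) : MvPolynomial (Fin n) ℤ :=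
  if h : 0 < i ∧ i < n then
    if hg : ∃ g, (X (⟨i - 1, by omega⟩ : Fin n) - X (⟨i, h.2⟩ : Fin n)) * g =
        X (⟨i - 1, by omega⟩ : Fin n) * f -
          X (⟨i, h.2⟩ : Fin n) *
            rename (⇑(Equiv.swap (⟨i - 1, by omega⟩ : Fin n) (⟨i, h.2⟩ : Fin n))) f then
      hg.choose
    else 0
  else f

/-- `π_{i_1} π_{i_2} ⋯ π_{i_ℓ} (f)` for a word `L = [i_1, …, i_ℓ]`. -/
def demWord (n : ℕ) (L : List ℕ) (f : MvPolynomial (Fin n) ℤ) : MvPolynomial (Fin n) ℤ :=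
  L.foldr (dem n) f

/-- Entry accessor for a composition, 0-indexed position, default `0` out of range. -/
def ent (n : ℕ) (α : Fin n → ℕ) (p : ℕ) : ℕ := if h : p < n then α ⟨p, h⟩ else 0

/-- Exchange the entries of `α` in (0-indexed) positions `p` and `p+1`. -/
def swapAt (n : ℕ) (p : ℕ) (α : Fin n → ℕ) : Fin n → ℕ := fun m =>
  if (m : ℕ) = p then ent n α (p + 1) else if (m : ℕ) = p + 1 then ent n α p else α m

/-- Auxiliary fuelled recursion computing the key polynomial `κ_α`:
if `α` is weakly decreasing, `κ_α = x^α`; otherwise, choosing an ascent `α_p < α_{p+1}`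
(0-indexed `p`), `κ_α = π_{p+1}(κ_{α̂})` where `α̂` swaps the two entries.  The fuel
`n*n` in `keyPoly` strictly exceeds the number of co-inversions, which drops by one at
each step, so the recursion always terminates at a weakly decreasing composition. -/
def keyAux (n : ℕ) : ℕ → (Fin n → ℕ) → MvPolynomial (Fin n) ℤ
  | 0, α => mono n α
  | k + 1, α =>
    if h : ∃ p : Fin n, ent n α p.1 < ent n α (p.1 + 1) then
      dem n (h.choose.1 + 1) (keyAux n k (swapAt n h.choose.1 α))
    else mono n α

/-- The key polynomial `κ_α`. -/
def keyPoly (n : ℕ) (α : Fin n → ℕ) : MvPolynomial (Fin n) ℤ := keyAux n (n * n) α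

/-- `wλ`, the composition `(λ_{w⁻¹(1)}, …, λ_{w⁻¹(n)})`. -/
def pact (n : ℕ) (w : Equiv.Perm (Fin n)) (lam : Fin n → ℕ) : Fin n → ℕ :=
  fun i => lam (w⁻¹ i)

/-- `lam` is a partition (weakly decreasing vector) with at most `n` parts. -/
def IsPartition (n : ℕ) (lam : Fin n → ℕ) : Prop := ∀ i j : Fin n, i ≤ j → lam j ≤ lam i

/-- Box `(c, r)` (column, row; both 1-indexed) belongs to the skyline diagram `D(α)`. -/
def InDiag (n : ℕ) (α : Fin n → ℕ) (c r : ℕ) : Prop :=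
  1 ≤ c ∧ c ≤ n ∧ 1 ≤ r ∧ r ≤ ent n α (c - 1)

/-- `F` (value of box (column, row)) is a filling of `D(α)` that is flagged (labels in
column `c` are in `{1, …, c}`) and row distinct. -/
def IsTab (n : ℕ) (α : Fin n → ℕ) (F : ℕ → ℕ → ℕ) : Prop :=
  (∀ c r, InDiag n α c r → 1 ≤ F c r ∧ F c r ≤ c) ∧
  ∀ c c' r, InDiag n α c r → InDiag n α c' r → c ≠ c' → F c r ≠ F c' r

/-- The weight of a filling: `wt(F)_i` = number of occurrences of the label `i`
(1-indexed; `Fin` position `i` records the label `i+1`). -/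
def wt (n : ℕ) (α : Fin n → ℕ) (F : ℕ → ℕ → ℕ) : Fin n → ℕ := fun i =>
  ((Finset.Icc 1 n ×ˢ Finset.Icc 1 (Finset.univ.sup α)).filter fun p =>
    InDiag n α p.1 p.2 ∧ F p.1 p.2 = i.1 + 1).card

/-- `leftmin_α(i) = min{α_j : j ≤ i}`. -/
def leftmin (n : ℕ) (α : Fin n → ℕ) (i : Fin n) : ℕ := sInf (α '' {j | j ≤ i})

/-- `rightmax_α(i) = max{α_j : j ≥ i}`. -/
def rightmax (n : ℕ) (α : Fin n → ℕ) (i : Fin n) : ℕ :=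
  Finset.sup (Finset.univ.filter fun j => i ≤ j) α

/-- `d` records `0 = d_0 < d_1 < ⋯ < d_k < d_{k+1} = n`. -/
def BlockData (n k : ℕ) (d : Fin (k + 2) → ℕ) : Prop :=
  d 0 = 0 ∧ d (Fin.last (k + 1)) = n ∧ StrictMono d

/-- `D = {d_1, …, d_k}` as a set of natural numbers. -/
def Dset (k : ℕ) (d : Fin (k + 2) → ℕ) : Set ℕ :=
  {m | ∃ t : Fin (k + 2), t ≠ 0 ∧ t ≠ Fin.last (k + 1) ∧ d t = m}

/-- `I = [n−1] ∖ D`. -/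
def Iset (n k : ℕ) (d : Fin (k + 2) → ℕ) : Set ℕ :=
  {m | 1 ≤ m ∧ m ≤ n - 1 ∧ m ∉ Dset k d}

/-- Positions `i, j` (of `Fin n`, 0-indexed; 1-indexed letters `i+1, j+1`) lie in the same
block: some `t` has `d_t < i+1, j+1 ≤ d_{t+1}`. -/
def SameBlock (n k : ℕ) (d : Fin (k + 2) → ℕ) (i j : Fin n) : Prop :=
  ∃ t : Fin (k + 1), d t.castSucc ≤ i.1 ∧ i.1 < d t.succ ∧ d t.castSucc ≤ j.1 ∧ j.1 < d t.succ

/-- The variables `X_t = {x_{d_t + 1}, …, x_{d_{t+1}}}` of the `t`-th block. -/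
def blockVars (n k : ℕ) (d : Fin (k + 2) → ℕ) (t : Fin (k + 1)) : Finset (Fin n) :=
  Finset.univ.filter fun p => d t.castSucc ≤ p.1 ∧ p.1 < d t.succ

/-- Complete homogeneous symmetric polynomial of degree `m` in the variables `S`. -/
def hPoly (n : ℕ) (S : Finset (Fin n)) (m : ℕ) : MvPolynomial (Fin n) ℤ :=
  ∑ f ∈ S.sym m, ((f : Multiset (Fin n)).map X).prod

/-- `h_z` for `z : ℤ`, with `h_z = 0` for `z < 0`. -/
def hZ (n : ℕ) (S : Finset (Fin n)) (z : ℤ) : MvPolynomial (Fin n) ℤ :=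
  if 0 ≤ z then hPoly n S z.toNat else 0

/-- The Schur polynomial `s_lam` in the variable set `S`, for a partition `lam`
(1-indexed parts, at most `t` of them), via the Jacobi–Trudi determinant
`det(h_{lam_i − i + j})_{1 ≤ i,j ≤ t}`. -/
def schurP (n : ℕ) (S : Finset (Fin n)) (t : ℕ) (lam : ℕ → ℕ) : MvPolynomial (Fin n) ℤ :=
  (Matrix.of fun i j : Fin t =>
    hZ n S ((lam (i.1 + 1) : ℤ) - (i.1 + 1) + (j.1 + 1))).det

/-- `γ ∈ Par_D`: a `(k+1)`-tuple of partitions, the `t`-th having at most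
`d_{t+1} − d_t` nonzero parts (1-indexed parts; the unused index `0` is normalized to `0`). -/
def ParD (k : ℕ) (d : Fin (k + 2) → ℕ) (γ : Fin (k + 1) → ℕ → ℕ) : Prop :=
  ∀ t : Fin (k + 1), γ t 0 = 0 ∧ (∀ a b : ℕ, 1 ≤ a → a ≤ b → γ t b ≤ γ t a) ∧
    ∀ m : ℕ, d t.succ - d t.castSucc < m → γ t m = 0

/-- The `D`-Schur polynomial `s_{γ^1,…,γ^{k+1}} = ∏_t s_{γ^t}(X_t)`. -/
def dSchur (n k : ℕ) (d : Fin (k + 2) → ℕ) (γ : Fin (k + 1) → ℕ → ℕ) :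
    MvPolynomial (Fin n) ℤ :=
  ∏ t : Fin (k + 1), schurP n (blockVars n k d t) (d t.succ - d t.castSucc) (γ t)

/-- Truncation of an integer vector to a natural-number vector. -/
def toNatV (n : ℕ) (β : Fin n → ℤ) : Fin n → ℕ := fun i => (β i).toNat

/-- `j − i` as an integer. -/
def gapZ (n : ℕ) (i j : Fin n) : ℤ := (j.1 : ℤ) - (i.1 : ℤ)

/-- The move `t_{ij}`: replace `β_i` by `β_j − (j−i)` and `β_j` by `β_i + (j−i)`. -/
def tmv (n : ℕ) (i j : Fin n) (β : Fin n → ℤ) : Fin n → ℤ := fun m =>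
  if m = i then β j - gapZ n i j else if m = j then β i + gapZ n i j else β m

/-- The rank `θ(β) = #{(a,b) : a < b in the same block and β_a < β_b − (b−a)}`. -/
def theta (n k : ℕ) (d : Fin (k + 2) → ℕ) (β : Fin n → ℤ) : ℕ :=
  (Finset.univ.filter fun p : Fin n × Fin n =>
    p.1 < p.2 ∧ SameBlock n k d p.1 p.2 ∧ β p.1 < β p.2 - gapZ n p.1 p.2).card

/-- One step up in the Bruhat-type order: `β ⋖ t_{ij} β` whenever `i < j` are in the same
block and `β_i > β_j − (j−i)`. -/
def stepUp (n k : ℕ) (d : Fin (k + 2) → ℕ) (β β' : Fin n → ℤ) : Prop :=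
  ∃ i j : Fin n, i < j ∧ SameBlock n k d i j ∧ β j - gapZ n i j < β i ∧ β' = tmv n i j β

/-- The order on compositions: transitive (reflexive) closure of `stepUp`. -/
def leB (n k : ℕ) (d : Fin (k + 2) → ℕ) : (Fin n → ℤ) → (Fin n → ℤ) → Prop :=
  Relation.ReflTransGen (stepUp n k d)

/-- Membership in the poset `P_{α,γ}` (for `α = cλ`): `β` is a weak composition with
`[x^β] κ_α ≠ 0` and `π_{w_0(I)}(x^β) = ± s_γ`. -/
def memP (n k : ℕ) (d : Fin (k + 2) → ℕ) (w0I : Equiv.Perm (Fin n)) (α : Fin n → ℕ)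
    (γ : Fin (k + 1) → ℕ → ℕ) (β : Fin n → ℤ) : Prop :=
  (∀ i, 0 ≤ β i) ∧ coeffOf n (toNatV n β) (keyPoly n α) ≠ 0 ∧
  ∃ L, IsRedWord n L w0I ∧
    (demWord n L (mono n (toNatV n β)) = dSchur n k d γ ∨
     demWord n L (mono n (toNatV n β)) = -dSchur n k d γ)

/-- The pair `i < j` is interweaved for `α`: `α_m ≥ α_{m+1}` for `i ≤ m < j`,
`leftmin_α(i) < α_i` and `rightmax_α(j) > α_j`. -/
def Interweaved (n : ℕ) (α : Fin n → ℕ) (i j : Fin n) : Prop :=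
  i < j ∧ (∀ p : Fin n, i ≤ p → p < j → ent n α (p.1 + 1) ≤ α p) ∧
  leftmin n α i < α i ∧ α j < rightmax n α j

/-- `center_α(i,j) = max{m : i ≤ m ≤ j and α_m ≥ rightmax_α(j)}` (as a 0-indexed position). -/
def center (n : ℕ) (α : Fin n → ℕ) (i j : Fin n) : ℕ :=
  Finset.sup (Finset.univ.filter fun p : Fin n => i ≤ p ∧ p ≤ j ∧ rightmax n α j ≤ α p)
    fun p => p.1

/-- Partial sum `β_1 + ⋯ + β_{m+1}` (0-indexed positions `≤ m`) of an integer vector. -/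
def psumZ (n : ℕ) (β : Fin n → ℤ) (m : ℕ) : ℤ :=
  ∑ p ∈ Finset.univ.filter (fun p : Fin n => p.1 ≤ m), β p

/-- Partial sum of a composition, as an integer. -/
def psumN (n : ℕ) (α : Fin n → ℕ) (m : ℕ) : ℤ :=
  ∑ p ∈ Finset.univ.filter (fun p : Fin n => p.1 ≤ m), (α p : ℤ)

/-- Composition pattern containment. -/
def ContainsPat (n : ℕ) {m : ℕ} (α : Fin n → ℕ) (pat : Fin m → ℕ) : Prop :=
  ∃ g : Fin m → Fin n, StrictMono g ∧
    (∀ s t : Fin m, pat s ≤ pat t ↔ α (g s) ≤ α (g t)) ∧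
    ∀ s t : Fin m, |(pat s : ℤ) - (pat t : ℤ)| ≤ |(α (g s) : ℤ) - (α (g t) : ℤ)|

end

end LSS
namespace LSS

lemma perm_apply_inv {n : ℕ} (v : Equiv.Perm (Fin n)) (x : Fin n) : v (v⁻¹ x) = x := by simp

lemma perm_inv_apply {n : ℕ} (v : Equiv.Perm (Fin n)) (x : Fin n) : v⁻¹ (v x) = x := by simp

lemma st_val (n i : ℕ) (h : 0 < i) (h' : i < n) (x : Fin n) :
    (st n i x).1 = if x.1 = i - 1 then i else if x.1 = i then i - 1 else x.1 := by
  unfold st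
  rw [dif_pos ⟨h, h'⟩, Equiv.swap_apply_def]
  simp only [Fin.ext_iff]
  split_ifs <;> simp_all

lemma st_mul_self (n i : ℕ) : st n i * st n i = 1 := by
  unfold st
  split_ifs <;> simp

lemma st_inv (n i : ℕ) : (st n i)⁻¹ = st n i :=
  inv_eq_of_mul_eq_one_left (st_mul_self n i)

lemma st_mul_cancel (n i : ℕ) (w : Equiv.Perm (Fin n)) : st n i * (st n i * w) = w := by
  rw [← mul_assoc, st_mul_self, one_mul]

lemma len_up (n i : ℕ) (u : Equiv.Perm (Fin n)) (a b : Fin n) (ha : a.1 + 1 = i) (hb : b.1 = i)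
    (h : u⁻¹ a < u⁻¹ b) : len n (st n i * u) = len n u + 1 := by
  unfold len
  rw [← Finset.card_insert_of_notMem (a := (u⁻¹ a, u⁻¹ b))]
  · congr 1
    ext ⟨x, y⟩
    simp only [Finset.mem_filter, Finset.mem_univ, true_and, Finset.mem_insert, Prod.mk.injEq,
      Equiv.Perm.mul_apply, Fin.lt_def, Equiv.Perm.eq_inv_iff_eq]
    have h1 := st_val n i (by omega) (by omega) (u x)
    have h2 := st_val n i (by omega) (by omega) (u y)
    have hx : u x = a → x = u⁻¹ a := fun e => by rw [← e]; simp
    have hy : u y = b → y = u⁻¹ b := fun e => by rw [← e]; simp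
    have hx' : u x = b → x = u⁻¹ b := fun e => by rw [← e]; simp
    have hy' : u y = a → y = u⁻¹ a := fun e => by rw [← e]; simp
    have hxy : u x = u y → x = y := fun e => u.injective e
    simp only [Fin.ext_iff, Fin.lt_def] at *
    rw [h1, h2]
    split_ifs <;> omega
  · simp only [Finset.mem_filter, Finset.mem_univ, true_and, not_and, perm_apply_inv,
      Fin.lt_def]
    omega

lemma st_inv_apply (n i : ℕ) (u : Equiv.Perm (Fin n)) (a : Fin n) :
    (st n i * u)⁻¹ a = u⁻¹ (st n i a) := by
  rw [mul_inv_rev, st_inv]; rfl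

lemma st_left (n i : ℕ) (a b : Fin n) (ha : a.1 + 1 = i) (hb : b.1 = i) : st n i a = b := by
  apply Fin.ext
  rw [st_val n i (by omega) (by omega)]
  split_ifs <;> omega

lemma st_right (n i : ℕ) (a b : Fin n) (ha : a.1 + 1 = i) (hb : b.1 = i) : st n i b = a := by
  apply Fin.ext
  rw [st_val n i (by omega) (by omega)]
  split_ifs <;> omega

lemma len_down (n i : ℕ) (u : Equiv.Perm (Fin n)) (a b : Fin n) (ha : a.1 + 1 = i) (hb : b.1 = i)
    (h : u⁻¹ b < u⁻¹ a) : len n u = len n (st n i * u) + 1 := by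
  have := len_up n i (st n i * u) a b ha hb
    (by rw [st_inv_apply, st_inv_apply, st_left n i a b ha hb, st_right n i a b ha hb]; exact h)
  rwa [st_mul_cancel] at this

lemma desc_of_lt (n i : ℕ) (u : Equiv.Perm (Fin n)) (a b : Fin n) (ha : a.1 + 1 = i)
    (hb : b.1 = i) (h : len n (st n i * u) ≤ len n u) : u⁻¹ b < u⁻¹ a := by
  by_contra hc
  rcases lt_or_eq_of_le (not_lt.mp hc) with h1 | h1
  · have := len_up n i u a b ha hb h1
    omega
  · have := u⁻¹.injective h1
    rw [this] at ha
    omega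

lemma len_inv (n : ℕ) (u : Equiv.Perm (Fin n)) : len n u⁻¹ = len n u := by
  unfold len
  refine Finset.card_bij (fun p _ => (u⁻¹ p.2, u⁻¹ p.1)) ?_ ?_ ?_
  · intro p hp
    simp only [Finset.mem_filter, Finset.mem_univ, true_and, perm_apply_inv] at *
    exact ⟨hp.2, hp.1⟩
  · rintro ⟨x, y⟩ _ ⟨x', y'⟩ _ h
    simp only [Prod.mk.injEq, EmbeddingLike.apply_eq_iff_eq] at h ⊢
    exact ⟨h.2, h.1⟩
  · rintro ⟨x, y⟩ h
    refine ⟨(u y, u x), ?_, by simp⟩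
    simp only [Finset.mem_filter, Finset.mem_univ, true_and, perm_inv_apply] at *
    exact ⟨h.2, h.1⟩

lemma eq_one_of_no_desc (n : ℕ) (u : Equiv.Perm (Fin n))
    (h : ∀ a b : Fin n, a.1 + 1 = b.1 → u⁻¹ a < u⁻¹ b) : u = 1 := by
  have hm : StrictMono (u⁻¹ : Equiv.Perm (Fin n)) := by
    intro a b hab
    obtain ⟨b, hb⟩ := b
    induction b with
    | zero => simp [Fin.lt_def] at hab
    | succ b ih =>
      have h1 := h ⟨b, by omega⟩ ⟨b+1, hb⟩ rfl
      by_cases hc : a.1 = b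
      · have : a = ⟨b, by omega⟩ := Fin.ext hc
        rw [this]; exact h1
      · exact lt_trans (ih (by omega) (by simp only [Fin.lt_def] at *; omega)) h1
  have h2 : u⁻¹ = 1 := by
    ext x
    have e : (hm.orderIsoOfSurjective _ u⁻¹.surjective) = OrderIso.refl _ := Subsingleton.elim _ _
    have := congrArg (fun f => f x) e
    simpa using congrArg Fin.val this
  simpa using h2

/-- letters other than `d` preserve `{x | x < d}`. -/
lemma st_pres (n a d : ℕ) (h : 1 ≤ a ∧ a ≤ n - 1) (had : a ≠ d) (x : Fin n) :
    (st n a x).1 < d ↔ x.1 < d := by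
  rw [st_val n a (by omega) (by omega)]
  split_ifs <;> omega

lemma word_pres (n d : ℕ) (L : List ℕ) (hL : ∀ i ∈ L, 1 ≤ i ∧ i ≤ n - 1) (hc : L.count d = 0)
    (x : Fin n) : ((L.map (st n)).prod x).1 < d ↔ x.1 < d := by
  induction L with
  | nil => simp
  | cons a L ih =>
    simp only [List.mem_cons, forall_eq_or_imp, List.count_cons] at *
    have had : a ≠ d := by rintro rfl; simp at hc
    rw [List.map_cons, List.prod_cons, Equiv.Perm.mul_apply, st_pres n a d hL.1 had]
    exact ih hL.2 (by omega)

lemma word_cross (n d : ℕ) (L : List ℕ) (hL : ∀ i ∈ L, 1 ≤ i ∧ i ≤ n - 1) (hc : L.count d ≤ 1)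
    (x y : Fin n) (hxy : x ≠ y) (e : x.1 < d ↔ y.1 < d)
    (ex : ((L.map (st n)).prod x).1 < d ↔ ¬ x.1 < d)
    (ey : ((L.map (st n)).prod y).1 < d ↔ ¬ y.1 < d) : False := by
  induction L with
  | nil => simp at ex; omega
  | cons a L ih =>
    simp only [List.mem_cons, forall_eq_or_imp, List.count_cons] at *
    rw [List.map_cons, List.prod_cons, Equiv.Perm.mul_apply] at ex ey
    by_cases had : a = d
    · subst had
      have hc0 : L.count a = 0 := by simp at hc; simpa using hc
      have h1 := word_pres n a L hL.2 hc0 x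
      have h2 := word_pres n a L hL.2 hc0 y
      have hne : (L.map (st n)).prod x ≠ (L.map (st n)).prod y := fun h =>
        hxy ((L.map (st n)).prod.injective h)
      rw [st_val n a (by omega) (by omega)] at ex ey
      rw [Ne, Fin.ext_iff] at hne
      split_ifs at ex ey <;> omega
    · rw [st_pres n a d hL.1 had] at ex ey
      exact ih hL.2 (by omega) ex ey

/-- Exchange. -/
lemma exch (n i : ℕ) (L : List ℕ) (hL : ∀ j ∈ L, 1 ≤ j ∧ j ≤ n - 1) (a b : Fin n)
    (ha : a.1 + 1 = i) (hb : b.1 = i)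
    (h : (L.map (st n)).prod⁻¹ b < (L.map (st n)).prod⁻¹ a) :
    ∃ (L1 L2 : List ℕ) (j : ℕ) (a' b' : Fin n), L = L1 ++ j :: L2 ∧ a'.1 + 1 = j ∧ b'.1 = j ∧
      (L1.map (st n)).prod a' = a ∧ (L1.map (st n)).prod b' = b := by
  induction L using List.reverseRecOn with
  | nil =>
    simp only [List.map_nil, List.prod_nil, inv_one, Equiv.Perm.one_apply, Fin.lt_def] at h
    omega
  | append_singleton L j ih =>
    have hL' : ∀ j ∈ L, 1 ≤ j ∧ j ≤ n - 1 := fun x hx => hL x (by simp [hx])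
    have hj := hL j (by simp)
    by_cases hc : (L.map (st n)).prod⁻¹ b < (L.map (st n)).prod⁻¹ a
    · obtain ⟨L1, L2, j', a', b', h1, h2⟩ := ih hL' hc
      exact ⟨L1, L2 ++ [j], j', a', b', by simp [h1], h2⟩
    · set p := (L.map (st n)).prod with hp
      have hne : p⁻¹ a ≠ p⁻¹ b := fun e => by
        have := p⁻¹.injective e
        rw [this] at ha; omega
      simp only [List.map_append, List.prod_append, List.map_cons, List.map_nil, List.prod_cons,
        List.prod_nil, mul_one, mul_inv_rev, st_inv, Equiv.Perm.mul_apply] at h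
      rw [← hp] at h
      have v1 := st_val n j (by omega) (by omega) (p⁻¹ a)
      have v2 := st_val n j (by omega) (by omega) (p⁻¹ b)
      rw [Fin.lt_def] at h hc
      rw [Ne, Fin.ext_iff] at hne
      have : (p⁻¹ a).1 + 1 = j ∧ (p⁻¹ b).1 = j := by
        rw [v1, v2] at h
        split_ifs at h <;> omega
      exact ⟨L, [], j, p⁻¹ a, p⁻¹ b, rfl, this.1, this.2, by rw [← hp]; simp, by rw [← hp]; simp⟩

lemma red_exch (n i : ℕ) (D : Set ℕ) (hi : i ∉ D) (L : List ℕ)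
    (w : Equiv.Perm (Fin n)) (hL : IsRedWord n L w) (hD : ∀ m ∈ D, L.count m ≤ 1) (a b : Fin n)
    (ha : a.1 + 1 = i) (hb : b.1 = i) (h : w⁻¹ b < w⁻¹ a) :
    ∃ (L1 L2 : List ℕ) (j : ℕ), L = L1 ++ j :: L2 ∧ IsRedWord n (L1 ++ L2) (st n i * w) ∧
      ∀ m ∈ D, j ≠ m ∧ (i < m ↔ j < m) := by
  obtain ⟨hr, hp, hlen⟩ := hL
  obtain ⟨L1, L2, j, a', b', e, ha', hb', pa, pb⟩ := exch n i L hr a b ha hb (by rw [hp]; exact h)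
  have hr1 : ∀ i ∈ L1, 1 ≤ i ∧ i ≤ n - 1 := fun x hx => hr x (by simp [e, hx])
  have hr2 : ∀ i ∈ L2, 1 ≤ i ∧ i ≤ n - 1 := fun x hx => hr x (by simp [e, hx])
  refine ⟨L1, L2, j, e, ⟨?_, ?_, ?_⟩, ?_⟩
  · intro x hx
    rcases List.mem_append.mp hx with h | h
    exacts [hr1 x h, hr2 x h]
  · have hs : st n i * (L1.map (st n)).prod = (L1.map (st n)).prod * st n j := by
      have hi' : st n i = Equiv.swap a b := by
        unfold st
        rw [dif_pos ⟨by omega, by omega⟩]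
        congr 1 <;> apply Fin.ext <;> simp <;> omega
      have hj' : st n j = Equiv.swap a' b' := by
        unfold st
        rw [dif_pos ⟨by omega, by omega⟩]
        congr 1 <;> apply Fin.ext <;> simp <;> omega
      rw [hi', hj', ← pa, ← pb, Equiv.swap_apply_apply]
      group
    rw [← hp, e]
    simp only [List.map_append, List.prod_append, List.map_cons, List.prod_cons]
    rw [← mul_assoc, hs, mul_assoc, ← mul_assoc (st n j), st_mul_self, one_mul]
  · have := len_down n i w a b ha hb h
    rw [e] at hlen
    simp at hlen ⊢
    omega
  · intro m hm
    have him : i ≠ m := fun h => hi (h ▸ hm)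
    have hc := hD m hm
    rw [e, List.count_append, List.count_cons] at hc
    have hjm : j ≠ m := by
      rintro rfl
      have hc0 : L1.count j = 0 := by
        simp only [beq_self_eq_true, if_true] at hc
        omega
      have p1 := word_pres n j L1 hr1 hc0 a'
      have p2 := word_pres n j L1 hr1 hc0 b'
      rw [pa] at p1
      rw [pb] at p2
      omega
    refine ⟨hjm, ?_⟩
    by_contra hcon
    refine word_cross n m L1 hr1 (by omega) a' b' ?_ ?_ ?_ ?_
    · rw [Ne, Fin.ext_iff]; omega
    · omega
    · rw [pa]; omega
    · rw [pb]; omega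

lemma len_le_length (n : ℕ) (A : List ℕ) (hA : ∀ i ∈ A, 1 ≤ i ∧ i ≤ n - 1) :
    len n (A.map (st n)).prod ≤ A.length := by
  induction A with
  | nil =>
    simp only [List.map_nil, List.prod_nil, List.length_nil, Nat.le_zero, len,
      Finset.card_eq_zero, Finset.filter_eq_empty_iff]
    intro p _ h
    exact lt_asymm h.1 h.2
  | cons i A ih =>
    have hi := hA i (by simp)
    have h1 := ih (fun j hj => hA j (by simp [hj]))
    rw [List.map_cons, List.prod_cons, List.length_cons]
    by_contra hc
    have h2 := len_down n i (st n i * (A.map (st n)).prod) ⟨i - 1, by omega⟩ ⟨i, by omega⟩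
      (by simp; omega) rfl
      (desc_of_lt n i _ _ _ (by simp; omega) rfl (by rw [st_mul_cancel]; omega))
    have h3 : ∀ v : Equiv.Perm (Fin n), len n (st n i * v) ≤ len n v + 1 := by
      intro v
      by_cases h : v⁻¹ (⟨i - 1, by omega⟩ : Fin n) < v⁻¹ (⟨i, by omega⟩ : Fin n)
      · exact (len_up n i v _ _ (by simp; omega) rfl h).le
      · by_contra hh
        exact absurd (len_up n i v ⟨i - 1, by omega⟩ ⟨i, by omega⟩ (by simp; omega) rfl) (by
          intro _
          have := len_down n i v ⟨i - 1, by omega⟩ ⟨i, by omega⟩ (by simp; omega) rfl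
            (lt_of_le_of_ne (not_lt.mp h) (by
              intro e
              have := congrArg Fin.val (v⁻¹.injective e)
              simp at this; omega))
          omega)
    have := h3 (A.map (st n)).prod
    omega

/-- The two letters lie in the same block. -/
lemma block_iff (n k : ℕ) (d : Fin (k + 2) → ℕ) (hd : BlockData n k d) (i j : ℕ)
    (hi : 1 ≤ i ∧ i ≤ n - 1) (hj : 1 ≤ j ∧ j ≤ n - 1) (hiD : i ∉ Dset k d)
    (h : ∀ m ∈ Dset k d, j ≠ m ∧ (i < m ↔ j < m)) (t : Fin (k + 1)) :
    (d t.castSucc < i ∧ i < d t.succ) ↔ (d t.castSucc < j ∧ j < d t.succ) := by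
  obtain ⟨h0, hn, hm⟩ := hd
  have e1 : d t.castSucc < i ↔ d t.castSucc < j := by
    by_cases ht : t.castSucc = 0
    · rw [ht, h0]; omega
    · have hmem : d t.castSucc ∈ Dset k d := ⟨_, ht, (Fin.castSucc_lt_last t).ne, rfl⟩
      have h1 := h _ hmem
      have h2 : i ≠ d t.castSucc := fun e => hiD (e ▸ hmem)
      omega
  have e2 : i < d t.succ ↔ j < d t.succ := by
    by_cases ht : t.succ = Fin.last (k + 1)
    · rw [ht, hn]; omega
    · exact (h _ ⟨_, Fin.succ_ne_zero t, ht, rfl⟩).2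
  rw [e1, e2]

lemma main_ind (n k : ℕ) (d : Fin (k + 2) → ℕ) (hd : BlockData n k d) (A : List ℕ) :
    ∀ (u w : Equiv.Perm (Fin n)) (L : List ℕ), IsRedWord n A u → (∀ i ∈ A, i ∉ Dset k d) →
    (∀ a b : Fin n, a < b → u⁻¹ b < u⁻¹ a → w⁻¹ b < w⁻¹ a) →
    IsRedWord n L w → (∀ m ∈ Dset k d, L.count m ≤ 1) →
    ∃ L'', IsRedWord n L'' (u⁻¹ * w) ∧ A.length + L''.length = L.length ∧
      (∀ m ∈ Dset k d, L''.count m ≤ L.count m) ∧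
      ∀ t : Fin (k + 1), (A ++ L'').countP (fun m => decide (d t.castSucc < m ∧ m < d t.succ)) =
        L.countP (fun m => decide (d t.castSucc < m ∧ m < d t.succ)) := by
  induction A with
  | nil =>
    intro u w L hA _ _ hL _
    have hu : u = 1 := by simpa using hA.2.1.symm
    subst hu
    exact ⟨L, by simpa using hL, by simp, fun _ _ => le_rfl, fun _ => rfl⟩
  | cons i A ih =>
    intro u w L hA hAD hinv hL hD
    obtain ⟨hr, hp, hlen⟩ := hA
    have hi := hr i (by simp)
    have hiD := hAD i (by simp)
    have hrA : ∀ j ∈ A, 1 ≤ j ∧ j ≤ n - 1 := fun j hj => hr j (by simp [hj])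
    obtain ⟨a, ha⟩ : ∃ a : Fin n, a.1 + 1 = i := ⟨⟨i - 1, by omega⟩, by simp; omega⟩
    obtain ⟨b, hb⟩ : ∃ b : Fin n, b.1 = i := ⟨⟨i, by omega⟩, rfl⟩
    have hpA : (A.map (st n)).prod = st n i * u := by
      rw [← hp, List.map_cons, List.prod_cons, st_mul_cancel]
    have hle := len_le_length n A hrA
    rw [hpA] at hle
    rw [List.length_cons] at hlen
    have hdu := desc_of_lt n i u a b ha hb (by omega)
    have hlu := len_down n i u a b ha hb hdu
    have hdw := hinv a b (by rw [Fin.lt_def]; omega) hdu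
    obtain ⟨L1, L2, j, e, hred, hbl⟩ := red_exch n i (Dset k d) hiD L w hL hD a b ha hb hdw
    have hj := hL.1 j (by simp [e])
    have hcount : ∀ m, (L1 ++ L2).count m ≤ L.count m := by
      intro m
      rw [e, List.count_append, List.count_append, List.count_cons]
      omega
    obtain ⟨L'', r1, r2, r3, r4⟩ := ih (st n i * u) (st n i * w) (L1 ++ L2)
      ⟨hrA, hpA, by omega⟩ (fun x hx => hAD x (by simp [hx]))
      (by
        intro x y hxy hu
        rw [st_inv_apply, st_inv_apply] at hu ⊢
        refine hinv _ _ ?_ hu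
        by_contra hc
        have v1 := st_val n i (by omega) (by omega) x
        have v2 := st_val n i (by omega) (by omega) y
        have hxy' : x = a ∧ y = b := by
          rw [Fin.lt_def] at hc hxy
          rw [Fin.ext_iff, Fin.ext_iff]
          rw [v1, v2] at hc
          split_ifs at hc <;> omega
        rw [hxy'.1, hxy'.2, st_left n i a b ha hb, st_right n i a b ha hb] at hu
        exact lt_asymm hu hdu)
      hred (fun m hm => (hcount m).trans (hD m hm))
    refine ⟨L'', ?_, ?_, fun m hm => (r3 m hm).trans (hcount m), ?_⟩
    · have : (st n i * u)⁻¹ * (st n i * w) = u⁻¹ * w := by group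
      rwa [this] at r1
    · rw [e]
      simp only [List.length_append, List.length_cons] at r2 ⊢
      omega
    · intro t
      have hb := block_iff n k d hd i j hi hj hiD hbl t
      rw [List.cons_append, List.countP_cons, r4 t, e, List.countP_append, List.countP_append,
        List.countP_cons]
      simp only [hb]
      omega

lemma parab_pres (n d : ℕ) (I : Set ℕ) (hI : ∀ i ∈ I, 1 ≤ i ∧ i ≤ n - 1) (hd : d ∉ I)
    (v : Equiv.Perm (Fin n)) (hv : v ∈ parab n I) (x : Fin n) : (v x).1 < d ↔ x.1 < d := by
  unfold parab at hv
  induction hv using Subgroup.closure_induction generalizing x with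
  | mem v hv =>
    obtain ⟨i, hi, rfl⟩ := hv
    exact st_pres n i d (hI i hi) (fun e => hd (e ▸ hi)) x
  | one => rfl
  | mul v v' _ _ h1 h2 => rw [Equiv.Perm.mul_apply, h1, h2]
  | inv v _ h => rw [← h (v⁻¹ x), perm_apply_inv]

lemma st_mem_parab (n i : ℕ) (I : Set ℕ) (hi : i ∈ I) : st n i ∈ parab n I :=
  Subgroup.subset_closure ⟨i, hi, rfl⟩

/-- Elements of the parabolic have reduced words with letters in `I`. -/
lemma parab_word (n : ℕ) (I : Set ℕ) (hI : ∀ i ∈ I, 1 ≤ i ∧ i ≤ n - 1) (N : ℕ) :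
    ∀ v ∈ parab n I, len n v = N → ∃ A, IsRedWord n A v ∧ ∀ i ∈ A, i ∈ I := by
  induction N with
  | zero =>
    intro v hv h0
    have : v = 1 := by
      apply eq_one_of_no_desc
      intro a b hab
      by_contra hc
      have hne : v⁻¹ b ≠ v⁻¹ a := fun e => by
        have := congrArg Fin.val (v⁻¹.injective e); omega
      have := len_down n b.1 v a b hab rfl (lt_of_le_of_ne (not_lt.mp hc) hne)
      omega
    subst this
    exact ⟨[], ⟨by simp, by simp, by simp [h0]⟩, by simp⟩
  | succ N ih =>
    intro v hv hN
    have hex : ∃ a b : Fin n, a.1 + 1 = b.1 ∧ v⁻¹ b < v⁻¹ a := by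
      by_contra hc
      push Not at hc
      have : v = 1 := by
        apply eq_one_of_no_desc
        intro a b hab
        refine lt_of_le_of_ne (hc a b hab) fun e => ?_
        have := congrArg Fin.val (v⁻¹.injective e); omega
      have h1 := len_le_length n [] (by simp)
      simp only [List.map_nil, List.prod_nil, List.length_nil, ← this] at h1
      omega
    obtain ⟨a, b, hab, hlt⟩ := hex
    have hbI : b.1 ∈ I := by
      by_contra hb
      have h1 := parab_pres n b.1 I hI hb v⁻¹ (inv_mem hv) a
      have h2 := parab_pres n b.1 I hI hb v⁻¹ (inv_mem hv) b
      rw [Fin.lt_def] at hlt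
      omega
    have hl := len_down n b.1 v a b hab rfl hlt
    obtain ⟨A, ⟨hA1, hA2, hA3⟩, hA4⟩ :=
      ih (st n b.1 * v) (mul_mem (st_mem_parab n _ I hbI) hv) (by omega)
    refine ⟨b.1 :: A, ⟨?_, ?_, ?_⟩, ?_⟩
    · intro i hi
      rcases List.mem_cons.mp hi with rfl | h
      exacts [hI _ hbI, hA1 i h]
    · rw [List.map_cons, List.prod_cons, hA2, st_mul_cancel]
    · rw [List.length_cons]; omega
    · intro i hi
      rcases List.mem_cons.mp hi with rfl | h
      exacts [hbI, hA4 i h]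

/-- Inversions of an element of the parabolic are inversions of any `w` with descents `⊇ I`. -/
lemma inv_sub (n : ℕ) (I : Set ℕ) (hI : ∀ i ∈ I, 1 ≤ i ∧ i ≤ n - 1) (v w : Equiv.Perm (Fin n))
    (hv : v ∈ parab n I)
    (hw : ∀ a b : Fin n, a.1 + 1 = b.1 → b.1 ∈ I → w⁻¹ b < w⁻¹ a)
    (a b : Fin n) (hab : a < b) (h : v⁻¹ b < v⁻¹ a) : w⁻¹ b < w⁻¹ a := by
  have hall : ∀ m, a.1 < m → m ≤ b.1 → m ∈ I := by
    intro m h1 h2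
    by_contra hm
    have p1 := parab_pres n m I hI hm v⁻¹ (inv_mem hv) a
    have p2 := parab_pres n m I hI hm v⁻¹ (inv_mem hv) b
    rw [Fin.lt_def] at h
    omega
  clear h
  obtain ⟨b, hb⟩ := b
  induction b with
  | zero => simp [Fin.lt_def] at hab
  | succ b ih =>
    simp only [Fin.lt_def] at hab
    have h1 := hw ⟨b, by omega⟩ ⟨b + 1, hb⟩ rfl (hall _ (by simpa using hab) le_rfl)
    by_cases hc : a.1 = b
    · have : a = ⟨b, by omega⟩ := Fin.ext hc
      rw [this]; exact h1
    · refine lt_trans h1 (ih (by omega) (by simp only [Fin.lt_def]; omega) ?_)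
      intro m h2 h3
      exact hall m h2 (by simp only at h3 ⊢; omega)

lemma longest_desc (n : ℕ) (I : Set ℕ) (v : Equiv.Perm (Fin n)) (h : IsLongest n I v) (a b : Fin n)
    (hab : a.1 + 1 = b.1) (hb : b.1 ∈ I) : v⁻¹ b < v⁻¹ a :=
  desc_of_lt n b.1 v a b hab rfl (h.2 _ (mul_mem (st_mem_parab n _ I hb) h.1))

lemma longest_inv (n : ℕ) (I : Set ℕ) (hI : ∀ i ∈ I, 1 ≤ i ∧ i ≤ n - 1) (v : Equiv.Perm (Fin n))
    (h : IsLongest n I v) : v⁻¹ = v := by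
  have h' : IsLongest n I v⁻¹ := ⟨inv_mem h.1, by rw [len_inv]; exact h.2⟩
  have key : v * v = 1 := by
    apply eq_one_of_no_desc
    intro a b hab
    rw [mul_inv_rev, Equiv.Perm.mul_apply, Equiv.Perm.mul_apply]
    by_cases hb : b.1 ∈ I
    · have h1 := longest_desc n I v h a b hab hb
      refine inv_sub n I hI v⁻¹ v h'.1 (longest_desc n I _ h) _ _ h1 ?_
      simp only [inv_inv, perm_apply_inv, Fin.lt_def]
      omega
    · rw [Fin.lt_def]
      have p1 := parab_pres n b.1 I hI hb v⁻¹ h'.1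
      have := p1 (v⁻¹ a)
      have := p1 (v⁻¹ b)
      have := p1 a
      have := p1 b
      omega
  exact inv_eq_of_mul_eq_one_left key


/-- Proposition 2.8: if `w` has an `I`-witness, then it has one of the
form `R′ R″` with `R′` a reduced word for `w_0(I)` and `R″` a reduced word for `w_0(I)w`. -/
theorem stmt5 (n k : ℕ) (d : Fin (k + 2) → ℕ) (hd : BlockData n k d)
    (w : Equiv.Perm (Fin n)) (I : Set ℕ) (hI : I ⊆ Descents n w)
    (hID : ∀ m, m ∈ I ↔ (1 ≤ m ∧ m ≤ n - 1 ∧ m ∉ Dset k d))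
    (w0I : Equiv.Perm (Fin n)) (h0 : IsLongest n I w0I)
    (L : List ℕ) (hLred : IsRedWord n L w)
    (hS1 : ∀ m ∈ Dset k d, L.count m ≤ 1)
    (hS2 : ∀ t : Fin (k + 1),
      (L.countP fun m => decide (d t.castSucc < m ∧ m < d t.succ)) <
        Nat.choose (d t.succ - d t.castSucc + 1) 2) :
    ∃ L' L'' : List ℕ, IsRedWord n L' w0I ∧ IsRedWord n L'' (w0I * w) ∧
      IsRedWord n (L' ++ L'') w ∧
      (∀ m ∈ Dset k d, (L' ++ L'').count m ≤ 1) ∧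
      ∀ t : Fin (k + 1),
        ((L' ++ L'').countP fun m => decide (d t.castSucc < m ∧ m < d t.succ)) <
          Nat.choose (d t.succ - d t.castSucc + 1) 2 := by
  have hI' : ∀ i ∈ I, 1 ≤ i ∧ i ≤ n - 1 := fun i hi => ⟨(hI hi).1, (hI hi).2.1⟩
  obtain ⟨A, hA, hAI⟩ := parab_word n I hI' _ w0I h0.1 rfl
  have hAD : ∀ i ∈ A, i ∉ Dset k d := fun i hi => ((hID i).mp (hAI i hi)).2.2
  have hinv := inv_sub n I hI' w0I w h0.1
    (fun a b hab hb => desc_of_lt n b.1 w a b hab rfl (hI hb).2.2.le)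
  obtain ⟨L'', r1, r2, r3, r4⟩ := main_ind n k d hd A w0I w L hA hAD hinv hLred hS1
  have hw0 : w0I⁻¹ * w = w0I * w := by rw [longest_inv n I hI' w0I h0]
  refine ⟨A, L'', hA, hw0 ▸ r1, ⟨?_, ?_, ?_⟩, ?_, ?_⟩
  · intro i hi
    rcases List.mem_append.mp hi with h | h
    exacts [hA.1 i h, r1.1 i h]
  · rw [List.map_append, List.prod_append, hA.2.1, r1.2.1, mul_inv_cancel_left]
  · rw [List.length_append, r2, hLred.2.2]
  · intro m hm
    have : A.count m = 0 := List.count_eq_zero.mpr fun h => hAD m h hm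
    rw [List.count_append, this, zero_add]
    exact (r3 m hm).trans (hS1 m hm)
  · intro t
    rw [r4 t]
    exact hS2 t

end LSS
end

section
/- For weak compositions α, β ∈ ℤ_{≥0}^n, the coefficient of the monomial x^β in the key polynomial κ_α is nonzero if and only if there exists a filling T ∈ Tab(α) with wt(T) = β. -/
open scoped Classical

namespace LSS

section crystal

variable {n : ℕ} (p q : Fin n)

/-- number of unmatched minus signs -/
def eps : List (Fin n → Bool) → ℕ
  | [] => 0
  | b :: T =>
    if b p = true ∧ b q = false then eps T - 1
    else if b p = false ∧ b q = true then eps T + 1 else eps T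

/-- number of unmatched plus signs -/
def phi : List (Fin n → Bool) → ℕ
  | [] => 0
  | b :: T =>
    if b p = true ∧ b q = false then (if eps p q T = 0 then phi T + 1 else phi T)
    else phi T

/-- raising operator -/
def ee : List (Fin n → Bool) → List (Fin n → Bool)
  | [] => []
  | b :: T =>
    if b p = false ∧ b q = true then
      (if eps p q T = 0 then (b ∘ Equiv.swap p q) :: T else b :: ee T)
    else b :: ee T

/-- lowering operator -/
def ff : List (Fin n → Bool) → List (Fin n → Bool)
  | [] => []
  | b :: T =>
    if b p = true ∧ b q = false then
      (if eps p q T = 0 then (b ∘ Equiv.swap p q) :: T else b :: ff T)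
    else b :: ff T

theorem flip_flip (b : Fin n → Bool) : (b ∘ Equiv.swap p q) ∘ Equiv.swap p q = b := by
  funext j; simp

theorem eps_ff (T : List (Fin n → Bool)) : 0 < phi p q T → eps p q (ff p q T) = eps p q T + 1 := by
  induction T with
  | nil => simp [phi]
  | cons b T ih =>
    simp only [phi, ff]
    rcases hp : b p <;> rcases hq : b q <;> by_cases h0 : eps p q T = 0 <;>
      simp [eps, hp, hq, h0] <;> intros <;> (try simp_all) <;> omega

theorem phi_ff (T : List (Fin n → Bool)) : 0 < phi p q T → phi p q (ff p q T) = phi p q T - 1 := by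
  induction T with
  | nil => simp [phi]
  | cons b T ih =>
    have := eps_ff p q T
    simp only [phi, ff]
    rcases hp : b p <;> rcases hq : b q <;> by_cases h0 : eps p q T = 0 <;>
      simp [phi, hp, hq, h0] <;> intros <;> (try simp_all)

theorem eps_ee (T : List (Fin n → Bool)) : 0 < eps p q T → eps p q (ee p q T) = eps p q T - 1 := by
  induction T with
  | nil => simp [eps]
  | cons b T ih =>
    simp only [eps, ee]
    rcases hp : b p <;> rcases hq : b q <;> by_cases h0 : eps p q T = 0 <;>
      simp [eps, hp, hq, h0] <;> intros <;> (try simp_all) <;> omega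

theorem phi_ee (T : List (Fin n → Bool)) : 0 < eps p q T → phi p q (ee p q T) = phi p q T + 1 := by
  induction T with
  | nil => simp [eps]
  | cons b T ih =>
    have := eps_ee p q T
    simp only [eps, ee]
    rcases hp : b p <;> rcases hq : b q <;> by_cases h0 : eps p q T = 0 <;>
      simp [phi, hp, hq, h0] <;> intros <;> (try simp_all) <;> grind

theorem ee_ff (T : List (Fin n → Bool)) : 0 < phi p q T → ee p q (ff p q T) = T := by
  induction T with
  | nil => simp [phi]
  | cons b T ih =>
    have := eps_ff p q T
    simp only [phi, ff]
    rcases hp : b p <;> rcases hq : b q <;> by_cases h0 : eps p q T = 0 <;>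
      simp [ee, hp, hq, h0, flip_flip] <;> intros <;> (try simp_all)

theorem ff_ee (T : List (Fin n → Bool)) : 0 < eps p q T → ff p q (ee p q T) = T := by
  induction T with
  | nil => simp [eps]
  | cons b T ih =>
    have := eps_ee p q T
    simp only [eps, ee]
    rcases hp : b p <;> rcases hq : b q <;> by_cases h0 : eps p q T = 0 <;>
      simp [ff, hp, hq, h0, flip_flip] <;> intros <;> (try simp_all) <;> grind

/-- the weight of a word of 0/1 vectors -/
def wtL (T : List (Fin n → Bool)) : Fin n → ℕ := fun j => T.countP (fun b => b j)

theorem phi_eps (T : List (Fin n → Bool)) :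
    phi p q T + wtL T q = eps p q T + wtL T p := by
  induction T with
  | nil => simp [phi, eps, wtL]
  | cons b T ih =>
    simp only [phi, eps, wtL, List.countP_cons] at *
    rcases hp : b p <;> rcases hq : b q <;> by_cases h0 : eps p q T = 0 <;>
      simp [h0] <;> omega

theorem wtL_ff (hpq : p ≠ q) (T : List (Fin n → Bool)) : 0 < phi p q T →
    wtL T p = wtL (ff p q T) p + 1 ∧ wtL (ff p q T) q = wtL T q + 1 ∧
    ∀ j, j ≠ p → j ≠ q → wtL (ff p q T) j = wtL T j := by
  induction T with
  | nil => simp [phi]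
  | cons b T ih =>
    have := eps_ff p q T
    simp only [phi, ff, wtL, List.countP_cons] at *
    rcases hp : b p <;> rcases hq : b q <;> by_cases h0 : eps p q T = 0 <;>
      simp [hp, hq, h0, List.countP_cons] <;> intros <;> (try simp_all) <;>
      simp [Equiv.swap_apply_of_ne_of_ne, *]

end crystal

section order

variable {n : ℕ}

/-- rank function -/
def Nr (n : ℕ) (α : Fin n → ℕ) (m r : ℕ) : ℕ := Nat.count (fun j => r < ent n α j) m

/-- Bruhat order on compositions (tableau criterion) -/
def leC (n : ℕ) (α' α : Fin n → ℕ) : Prop :=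
  (∀ m r, Nr n α m r ≤ Nr n α' m r) ∧ ∀ r, Nr n α' n r = Nr n α n r

theorem leC_refl (α : Fin n → ℕ) : leC n α α := ⟨fun _ _ => le_rfl, fun _ => rfl⟩

theorem leC_trans {a b c : Fin n → ℕ} (h : leC n a b) (h' : leC n b c) : leC n a c :=
  ⟨fun m r => (h'.1 m r).trans (h.1 m r), fun r => (h.2 r).trans (h'.2 r)⟩

theorem ent_val (α : Fin n → ℕ) (j : Fin n) : ent n α j.1 = α j := by simp [ent]

theorem Nr_succ (α : Fin n → ℕ) (m r : ℕ) :
    Nr n α (m+1) r = Nr n α m r + if r < ent n α m then 1 else 0 := Nat.count_succ _ _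

theorem ent_swap (α : Fin n → ℕ) (p q : Fin n) (m : ℕ) :
    ent n (α ∘ Equiv.swap p q) m = if m = p.1 then α q else if m = q.1 then α p else ent n α m := by
  unfold ent
  by_cases h : m < n
  · simp only [h, dif_pos, Function.comp, Equiv.swap_apply_def, Fin.ext_iff]
    split_ifs <;> rfl
  · have := p.2; have := q.2
    simp [h]; split_ifs <;> omega

theorem Nr_swap_le (α : Fin n → ℕ) (p q : Fin n) (hpq : q.1 = p.1 + 1) (m r : ℕ) (hm : m ≤ p.1) :
    Nr n (α ∘ Equiv.swap p q) m r = Nr n α m r := by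
  induction m with
  | zero => simp [Nr]
  | succ m ih =>
    have h1 : ent n (α ∘ Equiv.swap p q) m = ent n α m := by
      rw [ent_swap, if_neg (by omega), if_neg (by omega)]
    rw [Nr_succ, Nr_succ, ih (by omega), h1]

theorem Nr_swap_mid (α : Fin n → ℕ) (p q : Fin n) (hpq : q.1 = p.1 + 1) (r : ℕ) :
    Nr n (α ∘ Equiv.swap p q) (p.1+1) r = Nr n α p.1 r + if r < α q then 1 else 0 := by
  rw [Nr_succ, Nr_swap_le α p q hpq _ _ le_rfl, ent_swap, if_pos rfl]

theorem Nr_swap_ge (α : Fin n → ℕ) (p q : Fin n) (hpq : q.1 = p.1 + 1) (m r : ℕ)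
    (hm : p.1 + 2 ≤ m) : Nr n (α ∘ Equiv.swap p q) m r = Nr n α m r := by
  induction m, hm using Nat.le_induction with
  | base =>
    have h1 : ent n (α ∘ Equiv.swap p q) (p.1+1) = α p := by
      rw [ent_swap, if_neg (by omega), if_pos (by omega)]
    have h2 : ent n α (p.1 + 1) = α q := by rw [← hpq, ent_val]
    rw [Nr_succ, Nr_swap_mid α p q hpq, h1, Nr_succ, Nr_succ, ent_val, h2]; omega
  | succ m hm ih =>
    have h1 : ent n (α ∘ Equiv.swap p q) m = ent n α m := by
      rw [ent_swap, if_neg (by omega), if_neg (by omega)]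
    rw [Nr_succ, Nr_succ, ih, h1]

theorem Nr_mid (α : Fin n → ℕ) (p : Fin n) (r : ℕ) :
    Nr n α (p.1+1) r = Nr n α p.1 r + if r < α p then 1 else 0 := by
  rw [Nr_succ, ent_val]

theorem Nr_mid2 (α : Fin n → ℕ) (p q : Fin n) (hpq : q.1 = p.1 + 1) (r : ℕ) :
    Nr n α (p.1+2) r = Nr n α p.1 r + (if r < α p then 1 else 0) + if r < α q then 1 else 0 := by
  rw [Nr_succ, Nr_mid, ← hpq, ent_val]

theorem tri (p m : ℕ) : m ≤ p ∨ m = p + 1 ∨ p + 2 ≤ m := by omega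

/-- lifting property 1 -/
theorem leC_swap_left {c d : Fin n → ℕ} (p q : Fin n) (hpq : q.1 = p.1 + 1) (h : leC n c d)
    (hd : d p ≤ d q) : leC n (c ∘ Equiv.swap p q) d := by
  have hq := q.2
  refine ⟨fun m r => ?_, fun r => ?_⟩
  · rcases tri p m with hm | hm | hm
    · rw [Nr_swap_le c p q hpq _ _ hm]; exact h.1 m r
    · subst hm
      have h1 := h.1 (p.1) r
      have h2 := h.1 (p.1+1) r
      have h3 := h.1 (p.1+2) r
      rw [Nr_mid2 _ p q hpq, Nr_mid2 _ p q hpq] at h3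
      rw [Nr_mid, Nr_mid] at h2
      rw [Nr_swap_mid c p q hpq, Nr_mid]
      split_ifs at * <;> omega
    · rw [Nr_swap_ge c p q hpq _ _ hm]; exact h.1 m r
  · rw [Nr_swap_ge c p q hpq _ _ (by omega)]; exact h.2 r

/-- lifting property 2 -/
theorem leC_swap_right {c d : Fin n → ℕ} (p q : Fin n) (hpq : q.1 = p.1 + 1) (h : leC n c d)
    (hd : d p ≤ d q) (hc : c q ≤ c p) : leC n c (d ∘ Equiv.swap p q) := by
  have hq := q.2
  refine ⟨fun m r => ?_, fun r => ?_⟩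
  · rcases tri p m with hm | hm | hm
    · rw [Nr_swap_le d p q hpq _ _ hm]; exact h.1 m r
    · subst hm
      have h1 := h.1 (p.1) r
      have h2 := h.1 (p.1+1) r
      have h3 := h.1 (p.1+2) r
      rw [Nr_mid2 _ p q hpq, Nr_mid2 _ p q hpq] at h3
      rw [Nr_mid, Nr_mid] at h2
      rw [Nr_swap_mid d p q hpq, Nr_mid]
      split_ifs at * <;> omega
    · rw [Nr_swap_ge d p q hpq _ _ hm]; exact h.1 m r
  · rw [Nr_swap_ge d p q hpq _ _ (by omega)]; exact h.2 r

theorem swap_swap_comp {β : Type*} (d : Fin n → β) (p q : Fin n) :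
    (d ∘ Equiv.swap p q) ∘ Equiv.swap p q = d := by funext j; simp

theorem leC_swap_self {d : Fin n → ℕ} (p q : Fin n) (hpq : q.1 = p.1 + 1)
    (hd : d p ≤ d q) : leC n (d ∘ Equiv.swap p q) d :=
  leC_swap_left p q hpq (leC_refl d) hd

theorem leC_self_swap {d : Fin n → ℕ} (p q : Fin n) (hpq : q.1 = p.1 + 1)
    (hd : d q ≤ d p) : leC n d (d ∘ Equiv.swap p q) := by
  have := leC_swap_self (d := d ∘ Equiv.swap p q) p q hpq (by simpa using hd)
  rwa [swap_swap_comp] at this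

/-- remove the bottom row -/
def prd (α : Fin n → ℕ) : Fin n → ℕ := fun j => α j - 1

/-- the bottom row -/
def spp (α : Fin n → ℕ) : Fin n → Bool := fun j => decide (0 < α j)

theorem Nr_prd (α : Fin n → ℕ) (m r : ℕ) : Nr n (prd α) m r = Nr n α m (r+1) := by
  unfold Nr; congr 1; funext j; simp only [ent, prd]; split_ifs <;> simp <;> omega

theorem leC_prd {c d : Fin n → ℕ} (h : leC n c d) : leC n (prd c) (prd d) :=
  ⟨fun m r => by rw [Nr_prd, Nr_prd]; exact h.1 _ _, fun r => by rw [Nr_prd, Nr_prd]; exact h.2 _⟩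

theorem leC_decr {c d : Fin n → ℕ} (h : leC n c d) (hd : ∀ i j : Fin n, i ≤ j → d j ≤ d i) :
    c = d := by
  suffices H : ∀ m, m ≤ n → ∀ j, j < m → ent n c j = ent n d j by
    funext j; have := H n le_rfl j.1 j.2; rwa [ent_val, ent_val] at this
  intro m
  induction m with
  | zero => intro _ j hj; omega
  | succ m ih =>
    intro hm j hj
    have ih' := ih (by omega)
    rcases Nat.lt_succ_iff_lt_or_eq.1 hj with h1 | rfl
    · exact ih' j h1
    have hN : ∀ r, Nr n c j r = Nr n d j r := by
      intro r
      unfold Nr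
      rw [Nat.count_eq_card_filter_range, Nat.count_eq_card_filter_range]
      congr 1
      apply Finset.filter_congr
      intro x hx
      rw [ih' x (Finset.mem_range.1 hx)]
    apply le_antisymm
    · by_contra hlt
      push Not at hlt
      have h1 := h.2 (ent n d j)
      have h2 : Nr n c (j+1) (ent n d j) ≤ Nr n c n (ent n d j) := Nat.count_monotone _ hm
      rw [Nr_succ, if_pos hlt, hN] at h2
      have h3 : ∀ m, j ≤ m → m ≤ n → Nr n d m (ent n d j) = Nr n d j (ent n d j) := by
        intro m hm1
        induction m, hm1 using Nat.le_induction with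
        | base => intro _; rfl
        | succ m hm1 ih =>
          intro hm2
          have h5 := hd ⟨j, by omega⟩ ⟨m, by omega⟩ hm1
          have h6 : ¬ ent n d j < ent n d m := by
            have e1 := ent_val d ⟨j, by omega⟩
            have e2 := ent_val d ⟨m, by omega⟩
            simp only at e1 e2
            omega
          rw [Nr_succ, ih (by omega), if_neg h6, add_zero]
      have := h3 n (by omega) le_rfl
      omega
    · by_contra hlt
      push Not at hlt
      have h1 := h.1 (j+1) (ent n c j)
      rw [Nr_succ, Nr_succ, hN, if_pos hlt, if_neg (lt_irrefl _)] at h1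
      omega

end order

/-- Demazure sets of words -/
def DD (n : ℕ) : ℕ → (Fin n → ℕ) → Set (List (Fin n → Bool))
  | 0, _ => {[]}
  | k + 1, α => {T | ∃ α' T', leC n α' α ∧ T' ∈ DD n k (prd α') ∧ T = spp α' :: T'}

section dem
variable {n : ℕ}

theorem DD_mono {k : ℕ} {c d : Fin n → ℕ} (h : leC n c d) : DD n k c ⊆ DD n k d := by
  cases k with
  | zero => exact subset_rfl
  | succ k => rintro T ⟨a, T', h1, h2, h3⟩; exact ⟨a, T', leC_trans h1 h, h2, h3⟩

theorem DD_main (p q : Fin n) (hpq : q.1 = p.1 + 1) (k : ℕ) : ∀ α : Fin n → ℕ,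
    (∀ T ∈ DD n k α, 0 < eps p q T → ee p q T ∈ DD n k α ∧
      (0 < phi p q T → ff p q T ∈ DD n k α)) ∧
    (α p ≤ α q → ∀ T ∈ DD n k α, (0 < phi p q T → ff p q T ∈ DD n k α) ∧
      (eps p q T = 0 → T ∈ DD n k (α ∘ Equiv.swap p q))) := by
  have spps : ∀ a : Fin n → ℕ, spp a ∘ Equiv.swap p q = spp (a ∘ Equiv.swap p q) := fun a => rfl
  have prds : ∀ a : Fin n → ℕ, prd (a ∘ Equiv.swap p q) = prd a ∘ Equiv.swap p q := fun a => rfl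
  induction k with
  | zero =>
    intro α
    simp [DD, eps, phi]
  | succ k ih =>
    have mem : ∀ {α α' : Fin n → ℕ} {T'}, leC n α' α → T' ∈ DD n k (prd α') →
        spp α' :: T' ∈ DD n (k+1) α := fun h1 h2 => ⟨_, _, h1, h2, rfl⟩
    intro α
    have G : ∀ T ∈ DD n (k+1) α, 0 < eps p q T → ee p q T ∈ DD n (k+1) α ∧
      (0 < phi p q T → ff p q T ∈ DD n (k+1) α) := by
      rintro T ⟨a, T', h1, h2, rfl⟩ he
      rcases hp : spp a p <;> rcases hq : spp a q <;> by_cases h0 : eps p q T' = 0 <;>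
        simp only [eps, phi, ee, ff, hp, hq, h0] at he ⊢ <;> simp at he ⊢
      all_goals try omega
      · exact ⟨mem h1 ((ih _).1 _ h2 (by omega)).1, fun h => mem h1 (((ih _).1 _ h2 (by omega)).2 h)⟩
      · have hle : a p ≤ a q := by simp [spp] at hp hq; omega
        have hle' : prd a p ≤ prd a q := by simp only [prd]; omega
        refine ⟨?_, fun h => mem h1 (((ih _).2 hle' _ h2).1 h)⟩
        rw [spps]
        refine mem (leC_trans (leC_swap_self p q hpq hle) h1) ?_
        rw [prds]
        exact ((ih _).2 hle' _ h2).2 h0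
      · exact ⟨mem h1 ((ih _).1 _ h2 (by omega)).1, fun h => mem h1 (((ih _).1 _ h2 (by omega)).2 h)⟩
      · exact ⟨mem h1 ((ih _).1 _ h2 (by omega)).1, fun h => mem h1 (((ih _).1 _ h2 (by omega)).2 h)⟩
      · exact ⟨mem h1 ((ih _).1 _ h2 (by omega)).1, fun h => mem h1 (((ih _).1 _ h2 (by omega)).2 h)⟩
    refine ⟨G, ?_⟩
    rintro hα T hT
    refine ⟨fun hphi => ?_, fun he => ?_⟩
    · by_cases he : 0 < eps p q T
      · exact (G T hT he).2 hphi
      obtain ⟨a, T', h1, h2, rfl⟩ := hT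
      have h1' := leC_swap_left p q hpq h1 hα
      -- neutral case
      have neu : spp a p = spp a q → 0 < phi p q T' → spp a :: ff p q T' ∈ DD n (k+1) α := by
        intro hs hphi
        rcases le_total (a p) (a q) with hle | hle
        · have hle' : prd a p ≤ prd a q := by simp only [prd]; omega
          exact mem h1 (((ih _).2 hle' _ h2).1 hphi)
        · have hle' : prd a q ≤ prd a p := by simp only [prd]; omega
          have h3 : spp a = spp (a ∘ Equiv.swap p q) := by
            funext j
            change spp a j = spp a (Equiv.swap p q j)
            rw [Equiv.swap_apply_def]
            split_ifs with h h
            · rw [h, hs]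
            · rw [h, hs]
            · rfl
          rw [h3]
          refine mem h1' ?_
          rw [prds]
          exact ((ih _).2 (by simpa using hle') _ (DD_mono (leC_self_swap p q hpq hle') h2)).1 hphi
      rcases hp : spp a p <;> rcases hq : spp a q <;> by_cases h0 : eps p q T' = 0 <;>
        simp only [eps, phi, ee, ff, hp, hq, h0] at he hphi ⊢ <;> simp at he hphi ⊢
      all_goals try omega
      · exact neu (hp.trans hq.symm) hphi
      · have hle' : prd a q ≤ prd a p := by simp [spp, prd] at hp hq ⊢; omega
        rw [spps]
        refine mem h1' ?_
        rw [prds]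
        exact DD_mono (leC_self_swap p q hpq hle') h2
      · exact mem h1 (((ih _).1 _ h2 (by omega)).2 hphi)
      · exact neu (hp.trans hq.symm) hphi
    · obtain ⟨a, T', h1, h2, rfl⟩ := hT
      have h1' := leC_swap_left p q hpq h1 hα
      have neu : spp a p = spp a q → eps p q T' = 0 →
          spp a :: T' ∈ DD n (k+1) (α ∘ Equiv.swap p q) := by
        intro hs he
        rcases le_total (a p) (a q) with hle | hle
        · have hle' : prd a p ≤ prd a q := by simp only [prd]; omega
          have h3 : spp a = spp (a ∘ Equiv.swap p q) := by
            funext j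
            change spp a j = spp a (Equiv.swap p q j)
            rw [Equiv.swap_apply_def]
            split_ifs with h h
            · rw [h, hs]
            · rw [h, hs]
            · rfl
          rw [h3]
          refine mem (leC_swap_right p q hpq h1' hα (by simpa using hle)) ?_
          rw [prds]
          exact ((ih _).2 hle' _ h2).2 he
        · exact mem (leC_swap_right p q hpq h1 hα hle) h2
      rcases hp : spp a p <;> rcases hq : spp a q <;> 
        simp only [eps, hp, hq] at he <;> simp at he
      · exact neu (hp.trans hq.symm) he
      · have hle : a q ≤ a p := by simp [spp] at hp hq; omega
        exact mem (leC_swap_right p q hpq h1 hα hle) h2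
      · exact neu (hp.trans hq.symm) he

end dem
end LSS
namespace LSS

section iter
variable {n : ℕ} (p q : Fin n)

theorem ff_iter (hpq : p ≠ q) (T : List (Fin n → Bool)) (j : ℕ) : j ≤ phi p q T →
    eps p q ((ff p q)^[j] T) = eps p q T + j ∧ phi p q ((ff p q)^[j] T) = phi p q T - j ∧
    (ee p q)^[j] ((ff p q)^[j] T) = T ∧ wtL ((ff p q)^[j] T) p + j = wtL T p ∧
    wtL ((ff p q)^[j] T) q = wtL T q + j ∧
    ∀ i, i ≠ p → i ≠ q → wtL ((ff p q)^[j] T) i = wtL T i := by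
  induction j with
  | zero => simp
  | succ j ih =>
    intro hj
    obtain ⟨h1, h2, h3, h4, h5, h6⟩ := ih (by omega)
    have h0 : 0 < phi p q ((ff p q)^[j] T) := by omega
    obtain ⟨w1, w2, w3⟩ := wtL_ff p q hpq _ h0
    rw [Function.iterate_succ_apply' (ff p q), Function.iterate_succ_apply (ee p q), ee_ff p q _ h0,
      eps_ff p q _ h0, phi_ff p q _ h0]
    exact ⟨by omega, by omega, h3, by omega, by omega, fun i hi hi' => (w3 i hi hi').trans (h6 i hi hi')⟩

theorem ee_iter (T : List (Fin n → Bool)) (j : ℕ) : j ≤ eps p q T →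
    eps p q ((ee p q)^[j] T) = eps p q T - j ∧ phi p q ((ee p q)^[j] T) = phi p q T + j ∧
    (ff p q)^[j] ((ee p q)^[j] T) = T := by
  induction j with
  | zero => simp
  | succ j ih =>
    intro hj
    obtain ⟨h1, h2, h3⟩ := ih (by omega)
    have h0 : 0 < eps p q ((ee p q)^[j] T) := by omega
    rw [Function.iterate_succ_apply' (ee p q), Function.iterate_succ_apply (ff p q), ff_ee p q _ h0,
      eps_ee p q _ h0, phi_ee p q _ h0]
    exact ⟨by omega, by omega, h3⟩

theorem ff_iter_mem (S : Set (List (Fin n → Bool)))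
    (hS : ∀ T ∈ S, 0 < phi p q T → ff p q T ∈ S) (hpq : p ≠ q) (T) (hT : T ∈ S) (j : ℕ)
    (hj : j ≤ phi p q T) : (ff p q)^[j] T ∈ S := by
  induction j with
  | zero => simpa
  | succ j ih =>
    rw [Function.iterate_succ_apply']
    have := (ff_iter p q hpq T j (by omega)).2.1
    exact hS _ (ih (by omega)) (by omega)

theorem ee_iter_mem (S : Set (List (Fin n → Bool)))
    (hS : ∀ T ∈ S, 0 < eps p q T → ee p q T ∈ S) (T) (hT : T ∈ S) (j : ℕ)
    (hj : j ≤ eps p q T) : (ee p q)^[j] T ∈ S := by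
  induction j with
  | zero => simpa
  | succ j ih =>
    rw [Function.iterate_succ_apply']
    have := (ee_iter p q T j (by omega)).1
    exact hS _ (ih (by omega)) (by omega)

theorem sum_strings {M : Type*} [AddCommMonoid M] (hpq : p ≠ q)
    (S : Finset (List (Fin n → Bool)))
    (hf : ∀ T ∈ S, 0 < phi p q T → ff p q T ∈ S)
    (he : ∀ T ∈ S, 0 < eps p q T → ee p q T ∈ S) (g : List (Fin n → Bool) → M) :
    ∑ T ∈ S, g T = ∑ h ∈ S.filter (fun T => eps p q T = 0),
      ∑ j ∈ Finset.range (phi p q h + 1), g ((ff p q)^[j] h) := by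
  rw [Finset.sum_sigma']
  refine Finset.sum_bij' (fun T _ => ⟨(ee p q)^[eps p q T] T, eps p q T⟩)
    (fun x _ => (ff p q)^[x.2] x.1) ?_ ?_ ?_ ?_ ?_
  · intro T hT
    have h := ee_iter p q T _ le_rfl
    simp only [Finset.mem_sigma, Finset.mem_filter, Finset.mem_range]
    refine ⟨⟨ee_iter_mem p q (S : Set _) he T hT _ le_rfl, by omega⟩, by omega⟩
  · rintro ⟨h, j⟩ hx
    simp only [Finset.mem_sigma, Finset.mem_filter, Finset.mem_range] at hx
    exact ff_iter_mem p q (S : Set _) hf hpq h hx.1.1 j (by omega)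
  · intro T hT
    exact (ee_iter p q T _ le_rfl).2.2
  · rintro ⟨h, j⟩ hx
    simp only [Finset.mem_sigma, Finset.mem_filter, Finset.mem_range] at hx
    obtain ⟨h1, h2, h3, -⟩ := ff_iter p q hpq h j (by omega)
    simp only
    rw [h1, hx.1.2, zero_add, h3]
  · intro T hT
    simp only
    rw [(ee_iter p q T _ le_rfl).2.2]

open MvPolynomial

theorem mono_prod (w : Fin n → ℕ) : mono n w = ∏ i, (X i : MvPolynomial (Fin n) ℤ) ^ w i := by
  unfold mono
  rw [monomial_eq, Finsupp.prod_fintype _ _ (by simp)]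
  simp [expOf]

theorem mono_split (hpq : p ≠ q) (w : Fin n → ℕ) : mono n w = X p ^ w p * (X q ^ w q *
    ∏ i ∈ (Finset.univ.erase p).erase q, (X i : MvPolynomial (Fin n) ℤ) ^ w i) := by
  rw [mono_prod, ← Finset.mul_prod_erase _ _ (Finset.mem_univ p),
    ← Finset.mul_prod_erase _ _ (Finset.mem_erase.2 ⟨hpq.symm, Finset.mem_univ q⟩)]

/-- generating function of a finite set of words -/
noncomputable def gf (S : Finset (List (Fin n → Bool))) : MvPolynomial (Fin n) ℤ :=
  ∑ T ∈ S, mono n (wtL T)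

theorem gf_dem (hpq : p ≠ q) (S S' : Finset (List (Fin n → Bool))) (hsub : S ⊆ S')
    (hf' : ∀ T ∈ S', 0 < phi p q T → ff p q T ∈ S')
    (he' : ∀ T ∈ S', 0 < eps p q T → ee p q T ∈ S')
    (hg : ∀ T ∈ S, 0 < eps p q T → ee p q T ∈ S ∧ (0 < phi p q T → ff p q T ∈ S))
    (hh : ∀ T ∈ S', eps p q T = 0 → T ∈ S) :
    (X p - X q) * gf S' = X p * gf S - X q * rename (Equiv.swap p q) (gf S) := by
  have hS : gf S = ∑ T ∈ S', if T ∈ S then mono n (wtL T) else 0 := by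
    rw [← Finset.sum_filter, Finset.filter_mem_eq_inter, Finset.inter_eq_right.2 hsub]; rfl
  rw [hS, gf, sum_strings p q hpq S' hf' he', sum_strings p q hpq S' hf' he', map_sum,
    Finset.mul_sum, Finset.mul_sum, Finset.mul_sum, ← Finset.sum_sub_distrib]
  refine Finset.sum_congr rfl fun h hh0 => ?_
  obtain ⟨hhS', h0⟩ := Finset.mem_filter.1 hh0
  have hhS := hh h hhS' h0
  have hw := phi_eps p q h
  rw [h0, zero_add] at hw
  set l := phi p q h with hl
  set c := wtL h q with hc
  set Q : MvPolynomial (Fin n) ℤ := (X p * X q) ^ c *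
    ∏ i ∈ (Finset.univ.erase p).erase q, (X i : MvPolynomial (Fin n) ℤ) ^ wtL h i with hQ
  have hm : ∀ j ∈ Finset.range (l+1), mono n (wtL ((ff p q)^[j] h)) = Q * (X q ^ j * X p ^ (l - j)) := by
    intro j hj
    have hj' : j ≤ l := by have := Finset.mem_range.1 hj; omega
    obtain ⟨-, -, -, h4, h5, h6⟩ := ff_iter p q hpq h j hj'
    rw [mono_split p q hpq, h5, ← hc, show wtL ((ff p q)^[j] h) p = c + (l - j) by omega, hQ,
      Finset.prod_congr rfl (fun i hi => by
        rw [h6 i (Finset.mem_erase.1 (Finset.mem_erase.1 hi).2).1 (Finset.mem_erase.1 hi).1])]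
    ring
  have hsQ : rename (Equiv.swap p q) Q = Q := by
    rw [hQ, map_mul, map_pow, map_mul, rename_X, rename_X, Equiv.swap_apply_left,
      Equiv.swap_apply_right, map_prod, mul_comm (X q)]
    congr 1
    refine Finset.prod_congr rfl fun i hi => ?_
    rw [map_pow, rename_X, Equiv.swap_apply_of_ne_of_ne
      (Finset.mem_erase.1 (Finset.mem_erase.1 hi).2).1 (Finset.mem_erase.1 hi).1]
  have hsum := (Commute.all (X p : MvPolynomial (Fin n) ℤ) (X q)).mul_geom_sum₂ (l+1)
  have hsum' : (X p - X q : MvPolynomial (Fin n) ℤ) *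
      ∑ j ∈ Finset.range (l+1), X q ^ j * X p ^ (l - j) = X p ^ (l+1) - X q ^ (l+1) := by
    rw [← hsum, ← Finset.sum_range_reflect]
    congr 1
    refine Finset.sum_congr rfl fun j hj => ?_
    have := Finset.mem_range.1 hj
    rw [mul_comm]
    congr 2 <;> omega
  rw [Finset.sum_congr rfl hm, ← Finset.mul_sum]
  by_cases hc : 0 < l ∧ ff p q h ∈ S
  · have hall : ∀ j ∈ Finset.range (l+1), (ff p q)^[j] h ∈ S := by
      intro j
      induction j with
      | zero => intro _; exact hhS
      | succ j ih =>
        intro hj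
        have hj' := Finset.mem_range.1 hj
        rcases Nat.eq_zero_or_pos j with rfl | hj0
        · exact hc.2
        · obtain ⟨h1, h2, -⟩ := ff_iter p q hpq h j (by omega)
          rw [Function.iterate_succ_apply']
          exact (hg _ (ih (Finset.mem_range.2 (by omega))) (by omega)).2 (by omega)
    have e1 : ∑ j ∈ Finset.range (l+1), (if (ff p q)^[j] h ∈ S then
        mono n (wtL ((ff p q)^[j] h)) else 0) =
        Q * ∑ j ∈ Finset.range (l+1), (X q ^ j * X p ^ (l - j)) := by
      rw [Finset.mul_sum]
      exact Finset.sum_congr rfl fun j hj => by rw [if_pos (hall j hj), hm j hj]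
    have e2 : rename (Equiv.swap p q) (∑ j ∈ Finset.range (l+1),
        (X q ^ j * X p ^ (l - j) : MvPolynomial (Fin n) ℤ)) =
        ∑ j ∈ Finset.range (l+1), (X q ^ j * X p ^ (l - j)) := by
      rw [map_sum, ← Finset.sum_range_reflect]
      refine Finset.sum_congr rfl fun j hj => ?_
      have := Finset.mem_range.1 hj
      rw [map_mul, map_pow, map_pow, rename_X, rename_X, Equiv.swap_apply_left,
        Equiv.swap_apply_right, mul_comm]
      congr 2; omega
    rw [e1, map_mul, e2, hsQ]
    ring
  · have e1 : ∑ j ∈ Finset.range (l+1), (if (ff p q)^[j] h ∈ S then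
        mono n (wtL ((ff p q)^[j] h)) else 0) = Q * X p ^ l := by
      rw [Finset.sum_eq_single 0]
      · have := hm 0 (by simp)
        rw [Function.iterate_zero_apply, if_pos hhS]
        simpa using this
      · intro j hj hj0
        have hj' := Finset.mem_range.1 hj
        rw [if_neg]
        intro hmem
        apply hc
        refine ⟨by omega, ?_⟩
        clear hj
        induction j with
        | zero => exact absurd rfl hj0
        | succ j ih =>
          rcases Nat.eq_zero_or_pos j with rfl | hj1
          · exact hmem
          · apply ih (by omega) (by omega)
            obtain ⟨h1, h2, -⟩ := ff_iter p q hpq h j (by omega)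
            have h3 : 0 < phi p q ((ff p q)^[j] h) := by omega
            rw [Function.iterate_succ_apply'] at hmem
            have := (hg _ hmem (by rw [eps_ff p q _ h3]; omega)).1
            rwa [ee_ff p q _ h3] at this
      · simp
    rw [e1, map_mul, hsQ, map_pow, rename_X, Equiv.swap_apply_left]
    calc _ = Q * ((X p - X q) * ∑ j ∈ Finset.range (l+1), (X q ^ j * X p ^ (l - j))) := by ring
      _ = _ := by rw [hsum']; ring

end iter

section key
open MvPolynomial
variable {n : ℕ}

theorem DD_length (k : ℕ) : ∀ (α : Fin n → ℕ) (T), T ∈ DD n k α → T.length = k := by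
  induction k with
  | zero => intro α T h; rw [show T = [] from h]; rfl
  | succ k ih => rintro α T ⟨a, T', -, h, rfl⟩; simp [ih _ _ h]

theorem DD_finite (k : ℕ) (α : Fin n → ℕ) : (DD n k α).Finite :=
  (List.finite_length_eq (Fin n → Bool) k).subset fun T h => DD_length k α T h

/-- the finite set of Demazure words -/
noncomputable def DF (k : ℕ) (α : Fin n → ℕ) : Finset (List (Fin n → Bool)) :=
  (DD_finite k α).toFinset

theorem mem_DF {k : ℕ} {α : Fin n → ℕ} {T} : T ∈ DF k α ↔ T ∈ DD n k α := by simp [DF]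

theorem gf_DF (p q : Fin n) (hpq : q.1 = p.1 + 1) (k : ℕ) (α : Fin n → ℕ) (h : α p ≤ α q) :
    (X p - X q) * gf (DF k α) = X p * gf (DF k (α ∘ Equiv.swap p q)) -
      X q * rename (Equiv.swap p q) (gf (DF k (α ∘ Equiv.swap p q))) := by
  have hne : p ≠ q := by intro h; rw [h] at hpq; omega
  have m1 := DD_main p q hpq k α
  have m2 := DD_main p q hpq k (α ∘ Equiv.swap p q)
  apply gf_dem p q hne
  · intro T; rw [mem_DF, mem_DF]; exact fun hT => DD_mono (leC_swap_self p q hpq h) hT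
  · intro T; rw [mem_DF, mem_DF]; exact fun hT => (m1.2 h T hT).1
  · intro T; rw [mem_DF, mem_DF]; exact fun hT h0 => (m1.1 T hT h0).1
  · intro T; rw [mem_DF, mem_DF, mem_DF]; exact fun hT h0 => m2.1 T hT h0
  · intro T; rw [mem_DF, mem_DF]; exact fun hT h0 => (m1.2 h T hT).2 h0

theorem dem_gf (p q : Fin n) (hpq : q.1 = p.1 + 1) (k : ℕ) (α : Fin n → ℕ) (h : α p ≤ α q) :
    dem n (p.1 + 1) (gf (DF k (α ∘ Equiv.swap p q))) = gf (DF k α) := by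
  have hne : p ≠ q := by intro h; rw [h] at hpq; omega
  have key := gf_DF p q hpq k α h
  obtain ⟨q, hq⟩ := q
  simp only at hpq
  subst hpq
  unfold dem
  rw [dif_pos ⟨by omega, hq⟩]
  have hex : ∃ g, (X p - X (⟨p.1+1, hq⟩ : Fin n)) * g =
      X p * gf (DF k (α ∘ Equiv.swap p ⟨p.1+1, hq⟩)) -
      X (⟨p.1+1, hq⟩ : Fin n) * rename (Equiv.swap p ⟨p.1+1, hq⟩)
        (gf (DF k (α ∘ Equiv.swap p ⟨p.1+1, hq⟩))) := ⟨_, key⟩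
  have hp : (⟨p.1 + 1 - 1, by omega⟩ : Fin n) = p := rfl
  simp only [hp]
  rw [dif_pos hex]
  have h2 := hex.choose_spec
  refine mul_left_cancel₀ ?_ (h2.trans key.symm)
  rw [sub_ne_zero]
  intro h3
  exact hne (X_injective h3)

/-- the word of rows of a composition -/
def rowsW : ℕ → (Fin n → ℕ) → List (Fin n → Bool)
  | 0, _ => []
  | k + 1, α => spp α :: rowsW k (prd α)

theorem wtL_rowsW (k : ℕ) : ∀ (α : Fin n → ℕ), (∀ j, α j ≤ k) → wtL (rowsW k α) = α := by
  induction k with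
  | zero => intro α h; funext j; have := h j; simp [rowsW, wtL]; omega
  | succ k ih =>
    intro α h; funext j
    have h2 := congrFun (ih (prd α) (fun j => by have := h j; simp only [prd]; omega)) j
    simp only [wtL, rowsW, List.countP_cons] at h2 ⊢
    rw [h2]
    by_cases h3 : 0 < α j <;> simp [spp, prd, h3] <;> omega

theorem rowsW_mem (k : ℕ) : ∀ (α : Fin n → ℕ), rowsW k α ∈ DD n k α := by
  induction k with
  | zero => intro α; rfl
  | succ k ih => intro α; exact ⟨α, _, leC_refl α, ih _, rfl⟩

theorem DD_decr (k : ℕ) : ∀ (α : Fin n → ℕ), (∀ i j : Fin n, i ≤ j → α j ≤ α i) →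
    DD n k α = {rowsW k α} := by
  induction k with
  | zero => intro α _; rfl
  | succ k ih =>
    intro α h
    have ih' := ih (prd α) (fun i j hij => by have := h i j hij; simp only [prd]; omega)
    ext T
    constructor
    · rintro ⟨a, T', h1, h2, rfl⟩
      obtain rfl := leC_decr h1 h
      rw [ih'] at h2
      rw [show T' = _ from h2]; rfl
    · rintro rfl; exact rowsW_mem _ _

theorem decr_of_no_asc (α : Fin n → ℕ) (h : ¬ ∃ p : Fin n, ent n α p.1 < ent n α (p.1 + 1)) :
    ∀ i j : Fin n, i ≤ j → α j ≤ α i := by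
  push Not at h
  intro i j hij
  have : ∀ m, i.1 ≤ m → m < n → ent n α m ≤ ent n α i.1 := by
    intro m hm
    induction m, hm using Nat.le_induction with
    | base => intro _; rfl
    | succ m hm ih => intro h2; exact (h ⟨m, by omega⟩).trans (ih (by omega))
  have := this j.1 hij j.2
  rwa [ent_val, ent_val] at this

/-- number of coinversions -/
noncomputable def coinv (α : Fin n → ℕ) : ℕ :=
  (Finset.univ.filter fun x : Fin n × Fin n => x.1 < x.2 ∧ α x.1 < α x.2).card

theorem coinv_lt (p q : Fin n) (hpq : q.1 = p.1 + 1) (α : Fin n → ℕ) (h : α p < α q) :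
    coinv (α ∘ Equiv.swap p q) < coinv α := by
  unfold coinv
  rw [← Finset.card_map (Equiv.prodCongr (Equiv.swap p q) (Equiv.swap p q)).toEmbedding]
  apply Finset.card_lt_card
  rw [Finset.ssubset_iff_of_subset]
  · refine ⟨(p, q), by
      simp only [Finset.mem_filter, Finset.mem_univ, true_and]
      exact ⟨by rw [Fin.lt_def]; omega, h⟩, ?_⟩
    simp only [Finset.mem_map, Finset.mem_filter, Finset.mem_univ, true_and, not_exists]
    rintro ⟨a, b⟩ ⟨⟨h1, h2⟩, h3⟩
    simp only [Equiv.coe_toEmbedding, Equiv.prodCongr_apply, Prod.map_apply, Prod.mk.injEq] at h3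
    have ha : a = q := by
      have := congrArg (Equiv.swap p q) h3.1
      simpa using this
    have hb : b = p := by
      have := congrArg (Equiv.swap p q) h3.2
      simpa using this
    subst ha hb
    simp only [Fin.lt_def] at h1
    omega
  · intro x
    simp only [Finset.mem_map, Finset.mem_filter, Finset.mem_univ, true_and]
    rintro ⟨⟨a, b⟩, ⟨h1, h2⟩, rfl⟩
    refine ⟨?_, by simpa using h2⟩
    simp only [Equiv.coe_toEmbedding, Equiv.prodCongr_apply, Prod.map_apply]
    simp only [Function.comp, Equiv.swap_apply_def, Fin.ext_iff, Fin.lt_def] at h1 h2 ⊢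
    split_ifs at * <;> omega

theorem asc_next (α : Fin n → ℕ) (p : Fin n) (h : ent n α p.1 < ent n α (p.1 + 1)) :
    ∃ q : Fin n, q.1 = p.1 + 1 ∧ α p < α q ∧ swapAt n p.1 α = α ∘ Equiv.swap p q := by
  by_cases hq : p.1 + 1 < n
  · refine ⟨⟨p.1+1, hq⟩, rfl, ?_, ?_⟩
    · rw [ent_val] at h; simpa [ent, hq] using h
    · funext m
      simp only [swapAt, Function.comp, Equiv.swap_apply_def, Fin.ext_iff]
      split_ifs <;> simp [ent, hq]
  · simp [ent, hq] at h

theorem keyAux_gf (k : ℕ) (K : ℕ) : ∀ α : Fin n → ℕ, (∀ j, α j ≤ k) → coinv α ≤ K →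
    keyAux n K α = gf (DF k α) := by
  have base : ∀ α : Fin n → ℕ, (∀ j, α j ≤ k) →
      (¬ ∃ p : Fin n, ent n α p.1 < ent n α (p.1 + 1)) → mono n α = gf (DF k α) := by
    intro α h1 h2
    have : DF k α = {rowsW k α} := by
      ext T; rw [mem_DF, DD_decr k α (decr_of_no_asc α h2)]; simp
    rw [this, gf, Finset.sum_singleton, wtL_rowsW k α h1]
  induction K with
  | zero =>
    intro α h1 h2
    refine base α h1 ?_
    rintro ⟨p, hp⟩
    obtain ⟨q, hpq, hlt, -⟩ := asc_next α p hp
    have := coinv_lt p q hpq α hlt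
    omega
  | succ K ih =>
    intro α h1 h2
    rw [keyAux]
    split_ifs with h
    · obtain ⟨q, hpq, hlt, hs⟩ := asc_next α _ h.choose_spec
      have := coinv_lt _ q hpq α hlt
      rw [hs, ih (α ∘ Equiv.swap h.choose q) (fun j => h1 _) (by omega), dem_gf _ q hpq k α hlt.le]
    · exact base α h1 h

theorem keyPoly_gf (k : ℕ) (α : Fin n → ℕ) (h : ∀ j, α j ≤ k) : keyPoly n α = gf (DF k α) := by
  refine keyAux_gf k _ α h ?_
  unfold coinv
  refine (Finset.card_le_univ _).trans ?_
  simp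

theorem coeff_gf (S : Finset (List (Fin n → Bool))) (β : Fin n → ℕ) :
    coeffOf n β (gf S) ≠ 0 ↔ ∃ T ∈ S, wtL T = β := by
  have : coeffOf n β (gf S) = ((S.filter fun T => wtL T = β).card : ℤ) := by
    simp only [coeffOf, gf, mono, coeff_sum, coeff_monomial, expOf,
      EmbeddingLike.apply_eq_iff_eq, Finset.sum_boole]
  rw [this, Nat.cast_ne_zero, Finset.card_ne_zero]
  simp [Finset.Nonempty]

end key
end LSS
namespace LSS

section PPsec
variable {n : ℕ}

/-- indicator of a row -/
def chi (b : Fin n → Bool) : Fin n → ℕ := fun j => if b j = true then 1 else 0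

/-- product of row-wise Bruhat intervals -/
def PP (n : ℕ) : ℕ → (Fin n → ℕ) → Set (List (Fin n → Bool))
  | 0, _ => {[]}
  | k + 1, α => {T | ∃ b T', leC n (chi b) (chi (spp α)) ∧ T' ∈ PP n k (prd α) ∧ T = b :: T'}

theorem Nr_chi_spp (α : Fin n → ℕ) (m r : ℕ) :
    Nr n (chi (spp α)) m r = if r = 0 then Nr n α m 0 else 0 := by
  unfold Nr
  split_ifs with h
  · subst h
    congr 1; funext j; simp only [ent, chi, spp]; split_ifs <;> simp_all
  · rw [Nat.count_iff_forall_not]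
    intro j _
    simp only [ent, chi, spp, decide_eq_true_eq]; split_ifs <;> omega

theorem leC_spp {c d : Fin n → ℕ} (h : leC n c d) : leC n (chi (spp c)) (chi (spp d)) := by
  refine ⟨fun m r => ?_, fun r => ?_⟩
  · rw [Nr_chi_spp, Nr_chi_spp]; split_ifs
    · exact h.1 _ _
    · exact le_rfl
  · rw [Nr_chi_spp, Nr_chi_spp]; split_ifs
    · exact h.2 _
    · rfl

theorem PP_mono {k : ℕ} : ∀ {c d : Fin n → ℕ}, leC n c d → PP n k c ⊆ PP n k d := by
  induction k with
  | zero => intro c d _; exact subset_rfl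
  | succ k ih =>
    rintro c d h T ⟨b, T', h1, h2, h3⟩
    exact ⟨b, T', leC_trans h1 (leC_spp h), ih (leC_prd h) h2, h3⟩

theorem DD_sub_PP (k : ℕ) : ∀ (α : Fin n → ℕ), DD n k α ⊆ PP n k α := by
  induction k with
  | zero => intro α; exact subset_rfl
  | succ k ih =>
    rintro α T ⟨a, T', h1, h2, h3⟩
    exact ⟨spp a, T', leC_spp h1, PP_mono (leC_prd h1) (ih _ h2), h3⟩

theorem chi_inj {b c : Fin n → Bool} (h : chi b = chi c) : b = c := by
  funext j
  have := congrFun h j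
  simp only [chi] at this
  cases hb : b j <;> cases hc : c j <;> simp_all

theorem PP_decr (k : ℕ) : ∀ (α : Fin n → ℕ), (∀ i j : Fin n, i ≤ j → α j ≤ α i) →
    ∀ T ∈ PP n k α, T = rowsW k α := by
  induction k with
  | zero => intro α _ T h; exact h
  | succ k ih =>
    rintro α h T ⟨b, T', h1, h2, rfl⟩
    have ih' := ih (prd α) (fun i j hij => by have := h i j hij; simp only [prd]; omega) T' h2
    have := chi_inj (leC_decr h1 (fun i j hij => by
      have := h i j hij
      simp only [chi, spp, decide_eq_true_eq]
      split_ifs <;> omega))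
    rw [this, ih']; rfl

/-- flip a minus letter to a plus letter -/
def flp (p q : Fin n) (b : Fin n → Bool) : Fin n → Bool :=
  if b p = false ∧ b q = true then b ∘ Equiv.swap p q else b

theorem PP_flp (p q : Fin n) (hpq : q.1 = p.1 + 1) (k : ℕ) : ∀ (α : Fin n → ℕ), α p ≤ α q →
    ∀ T ∈ PP n k α, T.map (flp p q) ∈ PP n k (α ∘ Equiv.swap p q) := by
  induction k with
  | zero => intro α _ T h; rw [show T = [] from h]; rfl
  | succ k ih =>
    rintro α h T ⟨b, T', h1, h2, rfl⟩
    refine ⟨flp p q b, T'.map (flp p q), ?_,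
      ih (prd α) (by simp only [prd]; omega) T' h2, rfl⟩
    have hs : chi (spp α) p ≤ chi (spp α) q := by
      simp only [chi, spp, decide_eq_true_eq]
      split_ifs <;> omega
    change leC n _ (chi (spp α) ∘ Equiv.swap p q)
    apply leC_swap_right p q hpq _ hs
    · unfold flp
      split_ifs with hb
      · simp [chi, hb.1]
      · simp only [chi]
        cases hb1 : b p <;> cases hb2 : b q <;> simp_all
    · unfold flp
      split_ifs with hb
      · exact leC_swap_left p q hpq h1 hs
      · exact h1

theorem wtL_flp (p q : Fin n) (T : List (Fin n → Bool)) : ∃ j : ℕ,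
    wtL (T.map (flp p q)) p = wtL T p + j ∧ wtL (T.map (flp p q)) q + j = wtL T q ∧
    (∀ i, i ≠ p → i ≠ q → wtL (T.map (flp p q)) i = wtL T i) ∧ wtL T q ≤ wtL T p + j := by
  induction T with
  | nil => exact ⟨0, by simp [wtL]⟩
  | cons b T ih =>
    obtain ⟨j, h1, h2, h3, h4⟩ := ih
    simp only [wtL, List.map_cons, List.countP_cons] at h1 h2 h3 h4 ⊢
    by_cases hb : b p = false ∧ b q = true
    · refine ⟨j + 1, ?_, ?_, ?_, ?_⟩
      · simp only [flp, if_pos hb]; simp [hb.1, hb.2] at *; omega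
      · simp only [flp, if_pos hb]; simp [hb.1, hb.2] at *; omega
      · intro i hi hi'
        rw [h3 i hi hi']
        simp only [flp, if_pos hb, Function.comp, Equiv.swap_apply_of_ne_of_ne hi hi']
      · simp [hb.1, hb.2] at *; omega
    · refine ⟨j, ?_, ?_, ?_, ?_⟩
      · simp only [flp, if_neg hb] at *; omega
      · simp only [flp, if_neg hb] at *; omega
      · intro i hi hi'
        rw [h3 i hi hi', flp, if_neg hb]
      · cases hb1 : b p <;> cases hb2 : b q <;> simp_all <;> omega

theorem PP_wt (k K : ℕ) : ∀ α : Fin n → ℕ, coinv α ≤ K → ∀ T ∈ PP n k α,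
    ∃ T0 ∈ DD n k α, wtL T0 = wtL T := by
  induction K with
  | zero =>
    intro α hK T hT
    have hd := decr_of_no_asc α (by
      rintro ⟨p, hp⟩
      obtain ⟨q, hpq, hlt, -⟩ := asc_next α p hp
      have := coinv_lt p q hpq α hlt
      omega)
    exact ⟨_, rowsW_mem k α, by rw [PP_decr k α hd T hT]⟩
  | succ K ih =>
    intro α hK T hT
    by_cases hasc : ∃ p : Fin n, ent n α p.1 < ent n α (p.1 + 1)
    · obtain ⟨p, hp⟩ := hasc
      obtain ⟨q, hpq, hlt, -⟩ := asc_next α p hp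
      have hne : p ≠ q := by intro h; rw [h] at hpq; omega
      have hc := coinv_lt p q hpq α hlt
      obtain ⟨T0, hT0, hw⟩ := ih (α ∘ Equiv.swap p q) (by omega) _ (PP_flp p q hpq k α hlt.le T hT)
      obtain ⟨j, h1, h2, h3, h4⟩ := wtL_flp p q T
      have hT0' := DD_mono (leC_swap_self p q hpq hlt.le) hT0
      rw [← hw] at h1 h2 h3
      have hj : j ≤ phi p q T0 := by have := phi_eps p q T0; omega
      have hmem := ff_iter_mem p q (DD n k α)
        (fun T hT => ((DD_main p q hpq k α).2 hlt.le T hT).1) hne T0 hT0' j hj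
      obtain ⟨-, -, -, w1, w2, w3⟩ := ff_iter p q hne T0 j hj
      refine ⟨_, hmem, ?_⟩
      funext i
      by_cases hi : i = p
      · subst hi; omega
      by_cases hi' : i = q
      · subst hi'; omega
      rw [w3 i hi hi', h3 i hi hi']
    · exact ⟨_, rowsW_mem k α, by rw [PP_decr k α (decr_of_no_asc α hasc) T hT]⟩

theorem DD_PP_wt (k : ℕ) (α β : Fin n → ℕ) :
    (∃ T ∈ DD n k α, wtL T = β) ↔ ∃ T ∈ PP n k α, wtL T = β := by
  constructor
  · rintro ⟨T, h, h'⟩; exact ⟨T, DD_sub_PP k α h, h'⟩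
  · rintro ⟨T, h, rfl⟩; exact PP_wt k _ α le_rfl T h

end PPsec
end LSS
namespace LSS

section tabsec
variable {n : ℕ}

/-- a row as a set of naturals -/
def rowP (b : Fin n → Bool) (j : ℕ) : Prop := ∃ h : j < n, b ⟨j, h⟩ = true

theorem Nr_chi (b : Fin n → Bool) (m r : ℕ) :
    Nr n (chi b) m r = if r = 0 then Nat.count (rowP b) m else 0 := by
  unfold Nr
  split_ifs with h
  · subst h
    congr 1; funext j; simp only [ent, chi, rowP]; split_ifs <;> simp_all
  · rw [Nat.count_iff_forall_not]
    intro j _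
    simp only [ent, chi]; split_ifs <;> omega

theorem leC_chi (b c : Fin n → Bool) : leC n (chi b) (chi c) ↔
    (∀ m, Nat.count (rowP c) m ≤ Nat.count (rowP b) m) ∧
      Nat.count (rowP b) n = Nat.count (rowP c) n := by
  simp only [leC, Nr_chi]
  constructor
  · rintro ⟨h1, h2⟩
    exact ⟨fun m => by simpa using h1 m 0, by simpa using h2 0⟩
  · rintro ⟨h1, h2⟩
    exact ⟨fun m r => by split_ifs; exacts [h1 m, le_rfl], fun r => by split_ifs; exacts [h2, rfl]⟩

theorem row_exists (P C : ℕ → Prop) (hP : ∀ j, P j → j < n)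
    (h1 : ∀ m, Nat.count C m ≤ Nat.count P m) (h2 : Nat.count P n = Nat.count C n) :
    ∃ f : ℕ → ℕ, (∀ c, C c → f c ≤ c ∧ P (f c)) ∧
      (∀ c c', C c → C c' → f c = f c' → c = c') ∧ ∀ j, P j → ∃ c, C c ∧ f c = j := by
  have key : ∀ c, C c → Nat.count C c < Nat.count P (c+1) := by
    intro c hc
    refine lt_of_lt_of_le ?_ (h1 (c+1))
    rw [Nat.count_succ, if_pos hc]; omega
  have hcard : ∀ c, C c → ∀ hf : (setOf P).Finite, Nat.count C c < hf.toFinset.card := by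
    intro c hc hf
    refine lt_of_lt_of_le (key c hc) ?_
    rw [Nat.count_eq_card_filter_range]
    apply Finset.card_le_card
    intro x hx
    simp at hx ⊢
    exact hx.2
  refine ⟨fun c => Nat.nth P (Nat.count C c), ?_, ?_, ?_⟩
  · intro c hc
    exact ⟨Nat.lt_succ_iff.1 (Nat.nth_lt_of_lt_count (key c hc)), Nat.nth_mem _ (hcard c hc)⟩
  · intro c c' hc hc' h
    have h3 := Nat.count_nth (hcard c hc)
    have h4 := Nat.count_nth (hcard c' hc')
    have h5 : Nat.count C c = Nat.count C c' := by
      rw [← h3, ← h4]; exact congrArg _ h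
    exact Nat.count_injective hc hc' h5
  · intro j hj
    have h3 : Nat.count P j < Nat.count C n := by
      rw [← h2]
      exact Nat.count_strict_mono hj (hP j hj)
    have h4 : ∀ hf : (setOf C).Finite, Nat.count P j < hf.toFinset.card := by
      intro hf
      refine lt_of_lt_of_le h3 ?_
      rw [Nat.count_eq_card_filter_range]
      apply Finset.card_le_card
      intro x hx
      simp at hx ⊢
      exact hx.2
    refine ⟨Nat.nth C (Nat.count P j), Nat.nth_mem _ h4, ?_⟩
    simp only
    rw [Nat.count_nth h4, Nat.nth_count hj]

theorem row_count (P C : ℕ → Prop) (hC : ∀ j, C j → j < n) (f : ℕ → ℕ)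
    (h1 : ∀ c, C c → f c ≤ c ∧ P (f c))
    (h2 : ∀ c c', C c → C c' → f c = f c' → c = c') (h3 : ∀ j, P j → ∃ c, C c ∧ f c = j) :
    (∀ m, Nat.count C m ≤ Nat.count P m) ∧ Nat.count P n = Nat.count C n := by
  have A : ∀ m, Nat.count C m ≤ Nat.count P m := by
    intro m
    rw [Nat.count_eq_card_filter_range, Nat.count_eq_card_filter_range]
    apply Finset.card_le_card_of_injOn f
    · intro c hc
      simp at hc ⊢
      exact ⟨lt_of_le_of_lt (h1 c hc.2).1 hc.1, (h1 c hc.2).2⟩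
    · intro c hc c' hc' h
      simp at hc hc'
      exact h2 c c' hc.2 hc'.2 h
  refine ⟨A, le_antisymm ?_ (A n)⟩
  rw [Nat.count_eq_card_filter_range, Nat.count_eq_card_filter_range]
  refine le_trans (Finset.card_le_card ?_)
    (Finset.card_image_le (s := (Finset.range n).filter C) (f := f))
  intro j hj
  simp at hj ⊢
  obtain ⟨c, hc, hcj⟩ := h3 j hj.2
  exact ⟨c, ⟨hC c hc, hc⟩, hcj⟩

/-- level row of a composition -/
def lev (α : Fin n → ℕ) (r : ℕ) : Fin n → Bool := fun j => decide (r < α j)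

theorem rowP_lev (α : Fin n → ℕ) (r c : ℕ) : rowP (lev α r) c ↔ r < ent n α c := by
  simp only [rowP, lev, ent]
  split_ifs with h <;> simp [h]

theorem PP_of_rows (k : ℕ) : ∀ (α : Fin n → ℕ) (B : ℕ → Fin n → Bool),
    (∀ r, r < k → leC n (chi (B r)) (chi (lev α r))) → (List.range k).map B ∈ PP n k α := by
  induction k with
  | zero => intro α B _; rfl
  | succ k ih =>
    intro α B h
    rw [List.range_succ_eq_map, List.map_cons, List.map_map]
    refine ⟨B 0, _, h 0 (by omega), ih (prd α) (B ∘ Nat.succ) (fun r hr => ?_), rfl⟩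
    have := h (r+1) (by omega)
    have e : lev (prd α) r = lev α (r+1) := by
      funext j; simp only [lev, prd]; congr 1; apply propext; omega
    rw [e]; exact this

theorem rows_of_PP (k : ℕ) : ∀ (α : Fin n → ℕ), ∀ T ∈ PP n k α, ∃ B : ℕ → Fin n → Bool,
    T = (List.range k).map B ∧ ∀ r, r < k → leC n (chi (B r)) (chi (lev α r)) := by
  induction k with
  | zero => intro α T h; exact ⟨fun _ _ => true, by rw [show T = [] from h]; rfl, by omega⟩
  | succ k ih =>
    rintro α T ⟨b, T', h1, h2, rfl⟩
    obtain ⟨B, rfl, hB⟩ := ih _ _ h2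
    refine ⟨fun r => if r = 0 then b else B (r-1), ?_, ?_⟩
    · rw [List.range_succ_eq_map, List.map_cons, List.map_map]
      congr 1
    · intro r hr
      rcases r with _ | r
      · exact h1
      · have e : lev (prd α) r = lev α (r+1) := by
          funext j; simp only [lev, prd]; congr 1; apply propext; omega
        rw [← e]
        exact hB r (by omega)

theorem wtL_rows (k : ℕ) (B : ℕ → Fin n → Bool) (i : Fin n) :
    wtL ((List.range k).map B) i = ((Finset.range k).filter fun r => B r i = true).card := by
  induction k with
  | zero => simp [wtL]
  | succ k ih =>
    rw [Finset.range_add_one, Finset.filter_insert, List.range_succ]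
    simp only [wtL, List.map_append, List.countP_append, List.map_cons, List.map_nil] at ih ⊢
    rw [ih]
    split_ifs with h
    · rw [Finset.card_insert_of_notMem (by simp)]; simp [h]
    · simp [h]

theorem ent_le_sup (α : Fin n → ℕ) (c : ℕ) : ent n α c ≤ Finset.univ.sup α := by
  unfold ent
  split_ifs
  · exact Finset.le_sup (Finset.mem_univ _)
  · omega

theorem InDiag_succ (α : Fin n → ℕ) (c r : ℕ) : InDiag n α (c+1) (r+1) ↔ r < ent n α c := by
  unfold InDiag
  constructor
  · rintro ⟨-, -, -, h⟩; exact h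
  · intro h
    have : c < n := by
      by_contra hc
      simp [ent, hc] at h
    exact ⟨by omega, by omega, by omega, h⟩

theorem wt_rows (α : Fin n → ℕ) (F : ℕ → ℕ → ℕ) (hF : IsTab n α F) (B : ℕ → Fin n → Bool)
    (hB : ∀ r i, r < Finset.univ.sup α →
      (B r i = true ↔ ∃ c, r < ent n α c ∧ F (c+1) (r+1) = i.1 + 1)) :
    wt n α F = wtL ((List.range (Finset.univ.sup α)).map B) := by
  funext i
  rw [wtL_rows]
  unfold wt
  refine Finset.card_bij (fun x _ => x.2 - 1) ?_ ?_ ?_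
  · rintro ⟨c, r⟩ hx
    simp only [Finset.mem_filter, Finset.mem_product, Finset.mem_Icc, Finset.mem_range] at hx ⊢
    obtain ⟨⟨⟨h1, h2⟩, h3, h4⟩, h5, h6⟩ := hx
    obtain ⟨c, rfl⟩ := Nat.exists_eq_add_of_le' h1
    obtain ⟨r, rfl⟩ := Nat.exists_eq_add_of_le' h3
    refine ⟨by omega, (hB _ i (by omega)).2 ⟨c, (InDiag_succ α c r).1 h5, h6⟩⟩
  · rintro ⟨c, r⟩ hx ⟨c', r'⟩ hx' h
    simp only [Finset.mem_filter, Finset.mem_product, Finset.mem_Icc] at hx hx' h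
    obtain rfl : r = r' := by omega
    by_contra hne
    exact hF.2 c c' r hx.2.1 hx'.2.1 (fun e => hne (by rw [e])) (hx.2.2.trans hx'.2.2.symm)
  · intro r hr
    simp only [Finset.mem_filter, Finset.mem_range] at hr
    obtain ⟨c, h1, h2⟩ := (hB r i hr.1).1 hr.2
    have h3 := (InDiag_succ α c r).2 h1
    refine ⟨(c+1, r+1), ?_, rfl⟩
    simp only [Finset.mem_filter, Finset.mem_product, Finset.mem_Icc]
    exact ⟨⟨⟨h3.1, h3.2.1⟩, by omega, by omega⟩, h3, h2⟩

theorem ent_lt (α : Fin n → ℕ) {c r : ℕ} (h : r < ent n α c) : c < n := by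
  by_contra hc
  simp [ent, hc] at h

theorem tab_PP (α β : Fin n → ℕ) : (∃ F : ℕ → ℕ → ℕ, IsTab n α F ∧ wt n α F = β) ↔
    ∃ T ∈ PP n (Finset.univ.sup α) α, wtL T = β := by
  constructor
  · rintro ⟨F, hF, rfl⟩
    let B : ℕ → Fin n → Bool := fun r i => decide (∃ c, r < ent n α c ∧ F (c+1) (r+1) = i.1 + 1)
    refine ⟨_, PP_of_rows _ α B (fun r hr => ?_), (wt_rows α F hF B fun r i _ => by simp [B]).symm⟩
    rw [leC_chi]
    have hb : ∀ c, r < ent n α c → 1 ≤ F (c+1) (r+1) ∧ F (c+1) (r+1) ≤ c + 1 := fun c hc =>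
      hF.1 _ _ ((InDiag_succ α c r).2 hc)
    apply row_count (rowP (B r)) (rowP (lev α r)) (fun j hj => hj.1) (fun c => F (c+1) (r+1) - 1)
    · intro c hc
      rw [rowP_lev] at hc
      have h1 := hb c hc
      have h2 := ent_lt α hc
      refine ⟨by omega, by omega, ?_⟩
      simp only [B, decide_eq_true_eq]
      exact ⟨c, hc, by omega⟩
    · intro c c' hc hc' h
      rw [rowP_lev] at hc hc'
      have h1 := hb c hc
      have h2 := hb c' hc'
      by_contra hne
      exact hF.2 (c+1) (c'+1) (r+1) ((InDiag_succ α c r).2 hc) ((InDiag_succ α c' r).2 hc')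
        (by omega) (by omega)
    · rintro j ⟨hj, hj'⟩
      simp only [B, decide_eq_true_eq] at hj'
      obtain ⟨c, h1, h2⟩ := hj'
      exact ⟨c, (rowP_lev α r c).2 h1, by omega⟩
  · rintro ⟨T, hT, rfl⟩
    obtain ⟨B, rfl, hB⟩ := rows_of_PP _ α T hT
    have hrow : ∀ r, r < Finset.univ.sup α → ∃ f : ℕ → ℕ,
        (∀ c, rowP (lev α r) c → f c ≤ c ∧ rowP (B r) (f c)) ∧
        (∀ c c', rowP (lev α r) c → rowP (lev α r) c' → f c = f c' → c = c') ∧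
        ∀ j, rowP (B r) j → ∃ c, rowP (lev α r) c ∧ f c = j := by
      intro r hr
      obtain ⟨h1, h2⟩ := (leC_chi _ _).1 (hB r hr)
      exact row_exists (rowP (B r)) (rowP (lev α r)) (fun j hj => hj.1) h1 h2
    simp only [rowP_lev] at hrow
    choose! f hf using hrow
    have hlt : ∀ c r, r < ent n α c → r < Finset.univ.sup α := fun c r h =>
      lt_of_lt_of_le h (ent_le_sup α c)
    have hF : IsTab n α (fun c r => f (r-1) (c-1) + 1) := by
      constructor
      · intro c r h
        obtain ⟨c, rfl⟩ := Nat.exists_eq_add_of_le' h.1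
        obtain ⟨r, rfl⟩ := Nat.exists_eq_add_of_le' h.2.2.1
        rw [InDiag_succ] at h
        have := ((hf r (hlt c r h)).1 c h).1
        simp only [Nat.add_sub_cancel]
        omega
      · intro c c' r h h' hne
        obtain ⟨c, rfl⟩ := Nat.exists_eq_add_of_le' h.1
        obtain ⟨c', rfl⟩ := Nat.exists_eq_add_of_le' h'.1
        obtain ⟨r, rfl⟩ := Nat.exists_eq_add_of_le' h.2.2.1
        rw [InDiag_succ] at h h'
        simp only [Nat.add_sub_cancel]
        intro e
        have := (hf r (hlt c r h)).2.1 c c' h h' (by omega)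
        omega
    refine ⟨_, hF, wt_rows α _ hF B ?_⟩
    intro r i hr
    simp only [Nat.add_sub_cancel]
    obtain ⟨h1, -, h3⟩ := hf r hr
    constructor
    · intro hi
      obtain ⟨c, hc, hc'⟩ := h3 i.1 ⟨i.2, hi⟩
      exact ⟨c, hc, by omega⟩
    · rintro ⟨c, hc, hc'⟩
      obtain ⟨-, h4, h5⟩ := h1 c hc
      have : i = ⟨f r c, h4⟩ := Fin.ext (by simp only; omega)
      rw [this]; exact h5

end tabsec

/-- Theorem 4.5: `[x^β] κ_α ≠ 0` iff there is a row-distinct flagged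
filling of the skyline diagram of `α` with weight `β`. -/
theorem stmt7 (n : ℕ) (α β : Fin n → ℕ) :
    coeffOf n β (keyPoly n α) ≠ 0 ↔ ∃ F : ℕ → ℕ → ℕ, IsTab n α F ∧ wt n α F = β := by
  rw [keyPoly_gf (Finset.univ.sup α) α (fun j => Finset.le_sup (Finset.mem_univ j)), coeff_gf,
    tab_PP, ← DD_PP_wt]
  simp only [mem_DF]

end LSS
end
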